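/- arXiv:1603.00166 — 2 statements merged into one kernel-verified Lean document; each statement's English description precedes it below -/
import Mathlib

section
/- Let n ≥ 1, let f : ℝⁿ → ℝ be smooth, fix x₀ ∈ ℝⁿ, R ≥ 2, K ≥ 0, t₀ ∈ ℝ, T > 0 and D > 0. Assume ⟨Hess f(x) v, v⟩ ≥ −(n−1)K|v|² for all x in the ball B(x₀,R) and all v ∈ ℝⁿ, and let u be a smooth function on Q_{R,T} = B(x₀,R) × [t₀−T,t₀] with 0 < u ≤ D solving the f-heat equation ∂u/∂t = Δ_f u. Then there exists a constant c depending only on n such that for all (x,t) ∈ B(x₀,R/2) × (t₀−T, t₀], |∇u|(x,t)/√(u(x,t)) ≤ c·√D·( 1/R + √(|α|/R) + 1/√(t−t₀+T) + √K ), where α = max_{|x−x₀|=1} ( (n−1) − ⟨∇f(x), x−x₀⟩ ). (This is the Euclidean-space case of the paper's estimate (3.11), the a = 0 case of Theorem 1.1.) -/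
open Metric Set
open scoped RealInnerProductSpace

noncomputable section

/-- Euclidean Laplacian on `EuclideanSpace ℝ (Fin n)`. -/
def eLap {n : ℕ} (u : EuclideanSpace ℝ (Fin n) → ℝ) (x : EuclideanSpace ℝ (Fin n)) : ℝ :=
  ∑ i : Fin n,
    fderiv ℝ (fun y => fderiv ℝ u y (EuclideanSpace.single i 1)) x (EuclideanSpace.single i 1)

/-- Weighted (drift) Laplacian `Δ_f u = Δu − ⟨∇f, ∇u⟩`. -/
def fLap {n : ℕ} (f u : EuclideanSpace ℝ (Fin n) → ℝ) (x : EuclideanSpace ℝ (Fin n)) : ℝ :=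
  eLap u x - ⟪gradient f x, gradient u x⟫

/-- Hessian quadratic form of `f` at `x` evaluated at `(v, v)`. -/
def hessQF {n : ℕ} (f : EuclideanSpace ℝ (Fin n) → ℝ) (x v : EuclideanSpace ℝ (Fin n)) : ℝ :=
  fderiv ℝ (fun y => fderiv ℝ f y v) x v

/-- The constant `α = max_{|x−x₀|=1} ((n−1) − ⟨∇f(x), x−x₀⟩)`. -/
def alphaC {n : ℕ} (f : EuclideanSpace ℝ (Fin n) → ℝ) (x₀ : EuclideanSpace ℝ (Fin n)) : ℝ :=
  sSup ((fun y => (n : ℝ) - 1 - ⟪gradient f y, y - x₀⟫) '' sphere x₀ 1)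

lemma two_le_smooth : (2 : WithTop ℕ∞) ≤ ((⊤ : ℕ∞) : WithTop ℕ∞) := by
  change ((2 : ℕ∞) : WithTop ℕ∞) ≤ _
  exact WithTop.coe_le_coe.2 le_top

section Calculus
variable {W : Type*} [NormedAddCommGroup W] [NormedSpace ℝ W]

/-- Directional derivative operator. -/
def DD (v : W) (g : W → ℝ) : W → ℝ := fun p => fderiv ℝ g p v

/-- Smoothness at a point. -/
def Sm (g : W → ℝ) (p : W) : Prop := ContDiffAt ℝ (⊤ : ℕ∞) g p

lemma Sm.diff {g : W → ℝ} {p : W} (h : Sm g p) : DifferentiableAt ℝ g p :=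
  ContDiffAt.differentiableAt h (by simp)

lemma Sm.evd {g : W → ℝ} {p : W} (h : Sm g p) : ∀ᶠ q in nhds p, DifferentiableAt ℝ g q := by
  have h1 : ContDiffAt ℝ 1 g p := ContDiffAt.of_le h (by exact_mod_cast le_top)
  filter_upwards [h1.eventually (by simp)] with q hq
  exact hq.differentiableAt (by simp)

lemma Sm.D {g : W → ℝ} {p : W} (h : Sm g p) (v : W) : Sm (DD v g) p := by
  have h1 : ContDiffAt ℝ (⊤ : ℕ∞) (fderiv ℝ g) p := ContDiffAt.fderiv_right h (by simp)
  exact ContDiffAt.clm_apply h1 contDiffAt_const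

lemma Sm.mul {g h : W → ℝ} {p : W} (hg : Sm g p) (hh : Sm h p) : Sm (fun q => g q * h q) p :=
  ContDiffAt.mul hg hh

lemma Sm.sub {g h : W → ℝ} {p : W} (hg : Sm g p) (hh : Sm h p) : Sm (fun q => g q - h q) p :=
  ContDiffAt.sub hg hh

lemma Sm.add {g h : W → ℝ} {p : W} (hg : Sm g p) (hh : Sm h p) : Sm (fun q => g q + h q) p :=
  ContDiffAt.add hg hh

lemma Sm.sum {ι : Type*} {s : Finset ι} {g : ι → W → ℝ} {p : W} (hg : ∀ i ∈ s, Sm (g i) p) :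
    Sm (fun q => ∑ i ∈ s, g i q) p :=
  ContDiffAt.sum hg

lemma Sm.const (c : ℝ) (p : W) : Sm (fun _ => c) p := contDiffAt_const

lemma DD_congr {g h : W → ℝ} {p : W} (v : W) (e : g =ᶠ[nhds p] h) : DD v g p = DD v h p := by
  unfold DD; rw [e.fderiv_eq]

lemma DD_comm2 {g : W → ℝ} {p : W} (h : ContDiffAt ℝ 2 g p) (v w : W) :
    DD v (DD w g) p = DD w (DD v g) p := by
  have h1 : ContDiffAt ℝ 1 (fderiv ℝ g) p := ContDiffAt.fderiv_right h (by norm_num)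
  have hd : DifferentiableAt ℝ (fderiv ℝ g) p := h1.differentiableAt (by simp)
  have hs := ContDiffAt.isSymmSndFDerivAt (𝕜 := ℝ) h (by simp) v w
  have key : ∀ a b : W, DD a (DD b g) p = fderiv ℝ (fderiv ℝ g) p a b := by
    intro a b
    have := (hd.hasFDerivAt.clm_apply (hasFDerivAt_const b p)).fderiv
    change fderiv ℝ (fun q => fderiv ℝ g q b) p a = _
    rw [this]; simp
  rw [key, key, hs]

lemma DD_comm {g : W → ℝ} {p : W} (h : Sm g p) (v w : W) :
    DD v (DD w g) p = DD w (DD v g) p :=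
  DD_comm2 (ContDiffAt.of_le h two_le_smooth) v w

lemma DD_mul {g h : W → ℝ} {p : W} (hg : DifferentiableAt ℝ g p) (hh : DifferentiableAt ℝ h p)
    (v : W) : DD v (fun q => g q * h q) p = g p * DD v h p + h p * DD v g p := by
  change fderiv ℝ (fun q => g q * h q) p v = _
  rw [fderiv_fun_mul hg hh]; simp [DD]

lemma DD_sub {g h : W → ℝ} {p : W} (hg : DifferentiableAt ℝ g p) (hh : DifferentiableAt ℝ h p)
    (v : W) : DD v (fun q => g q - h q) p = DD v g p - DD v h p := by
  change fderiv ℝ (fun q => g q - h q) p v = _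
  rw [fderiv_fun_sub hg hh]; simp [DD]

lemma DD_add {g h : W → ℝ} {p : W} (hg : DifferentiableAt ℝ g p) (hh : DifferentiableAt ℝ h p)
    (v : W) : DD v (fun q => g q + h q) p = DD v g p + DD v h p := by
  change fderiv ℝ (fun q => g q + h q) p v = _
  rw [fderiv_fun_add hg hh]; simp [DD]

lemma DD_const (c : ℝ) (p : W) (v : W) : DD v (fun _ : W => c) p = 0 := by
  simp [DD]

lemma DD_sum {ι : Type*} {s : Finset ι} {g : ι → W → ℝ} {p : W}
    (hg : ∀ i ∈ s, DifferentiableAt ℝ (g i) p) (v : W) :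
    DD v (fun q => ∑ i ∈ s, g i q) p = ∑ i ∈ s, DD v (g i) p := by
  change fderiv ℝ (fun q => ∑ i ∈ s, g i q) p v = _
  rw [fderiv_fun_sum hg]; simp [DD]

/-- second derivative of a product -/
lemma DD_DD_mul {g h : W → ℝ} {p : W} (hg : Sm g p) (hh : Sm h p) (v : W) :
    DD v (DD v (fun q => g q * h q)) p
      = g p * DD v (DD v h) p + 2 * (DD v g p * DD v h p) + h p * DD v (DD v g) p := by
  have e : DD v (fun q => g q * h q) =ᶠ[nhds p] fun q => g q * DD v h q + h q * DD v g q := by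
    filter_upwards [hg.evd, hh.evd] with q h1 h2
    exact DD_mul h1 h2 v
  rw [DD_congr v e, DD_add (hg.mul (hh.D v)).diff (hh.mul (hg.D v)).diff,
    DD_mul hg.diff (hh.D v).diff, DD_mul hh.diff (hg.D v).diff]
  ring

lemma DD_DD_sub {g h : W → ℝ} {p : W} (hg : Sm g p) (hh : Sm h p) (v : W) :
    DD v (DD v (fun q => g q - h q)) p = DD v (DD v g) p - DD v (DD v h) p := by
  have e : DD v (fun q => g q - h q) =ᶠ[nhds p] fun q => DD v g q - DD v h q := by
    filter_upwards [hg.evd, hh.evd] with q h1 h2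
    exact DD_sub h1 h2 v
  rw [DD_congr v e, DD_sub (hg.D v).diff (hh.D v).diff]

lemma DD_DD_sum {ι : Type*} {s : Finset ι} {g : ι → W → ℝ} {p : W}
    (hg : ∀ i ∈ s, Sm (g i) p) (v : W) :
    DD v (DD v (fun q => ∑ i ∈ s, g i q)) p = ∑ i ∈ s, DD v (DD v (g i)) p := by
  have e : DD v (fun q => ∑ i ∈ s, g i q) =ᶠ[nhds p] fun q => ∑ i ∈ s, DD v (g i) q := by
    have : ∀ᶠ q in nhds p, ∀ i ∈ s, DifferentiableAt ℝ (g i) q :=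
      (Filter.eventually_all_finset s).2 fun i hi => (hg i hi).evd
    filter_upwards [this] with q h1
    exact DD_sum h1 v
  rw [DD_congr v e, DD_sum (fun i hi => ((hg i hi).D v).diff)]

/-- derivative along a line -/
lemma DD_line {g : W → ℝ} {p v : W} {s : ℝ} (h : DifferentiableAt ℝ g (p + s • v)) :
    HasDerivAt (fun s : ℝ => g (p + s • v)) (DD v g (p + s • v)) s := by
  have h1 : HasDerivAt (fun s : ℝ => p + s • v) v s := by
    simpa using ((hasDerivAt_id s).smul_const v).const_add p
  exact h.hasFDerivAt.comp_hasDerivAt s h1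

lemma line_tendsto (p v : W) : Filter.Tendsto (fun s : ℝ => p + s • v) (nhds 0) (nhds p) := by
  have : Continuous (fun s : ℝ => p + s • v) := by fun_prop
  simpa using this.tendsto 0

lemma DD_zero_of_max {g : W → ℝ} {p v : W} (h : Sm g p)
    (hm : IsLocalMax (fun s : ℝ => g (p + s • v)) 0) : DD v g p = 0 := by
  have h1 := DD_line (g := g) (p := p) (v := v) (s := 0) (by simpa using h.diff)
  simpa using hm.hasDerivAt_eq_zero h1

lemma DD_DD_nonpos_of_max {g : W → ℝ} {p v : W} (h : Sm g p)
    (hm : IsLocalMax (fun s : ℝ => g (p + s • v)) 0) : DD v (DD v g) p ≤ 0 := by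
  by_contra hpos
  push Not at hpos
  set ψ : ℝ → ℝ := fun s : ℝ => g (p + s • v) with hψ
  have e1 : deriv ψ =ᶠ[nhds 0] fun s => DD v g (p + s • v) := by
    filter_upwards [(line_tendsto p v).eventually h.evd] with s hs
    exact (DD_line hs).deriv
  have e2 : deriv (deriv ψ) 0 = DD v (DD v g) p := by
    rw [e1.deriv_eq]
    have := DD_line (g := DD v g) (p := p) (v := v) (s := 0) (by simpa using (h.D v).diff)
    simpa using this.deriv
  have hmin : IsLocalMin ψ 0 := by
    refine isLocalMin_of_deriv_deriv_pos (by rw [e2]; exact hpos) hm.deriv_eq_zero ?_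
    exact (DD_line (s := 0) (by simpa using h.diff)).continuousAt
  have ec : ψ =ᶠ[nhds 0] fun _ => ψ 0 := by
    filter_upwards [hm, hmin] with s h1 h2
    exact le_antisymm h1 h2
  have : deriv (deriv ψ) 0 = 0 := by
    have : deriv ψ =ᶠ[nhds 0] fun _ => 0 := by
      have := ec.deriv
      simpa using this
    rw [this.deriv_eq]; simp
  linarith

/-- one sided: if `g ≤ g p` on the backward half line, the derivative is nonnegative. -/
lemma DD_nonneg_of_left {g : W → ℝ} {p v : W} (h : Sm g p)
    (hm : ∀ᶠ s : ℝ in nhdsWithin 0 (Iio 0), g (p + s • v) ≤ g p) : 0 ≤ DD v g p := by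
  have h1 := DD_line (g := g) (p := p) (v := v) (s := 0) (by simpa using h.diff)
  have h2 := h1.hasDerivWithinAt (s := Iio 0)
  rw [hasDerivWithinAt_iff_tendsto_slope' (by simp)] at h2
  refine ge_of_tendsto (by simpa using h2) ?_
  filter_upwards [hm, self_mem_nhdsWithin] with s hs hs0
  have hs0 : s < 0 := hs0
  simp only [slope, vsub_eq_sub, sub_zero, zero_smul, add_zero, smul_eq_mul]
  exact mul_nonneg_of_nonpos_of_nonpos (inv_nonpos.2 hs0.le) (by linarith)

end Calculus

lemma scalar_core {u g Ψ κ S X Y Z H Rc Λ p : ℝ} (hu : 0 < u) (hg : 0 < g) (hΨ : 0 < Ψ)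
    (hp : p * u = g) (hY : Ψ * Y = Ψ * p * X - g * S)
    (hZ : Ψ ^ 2 * Z = Ψ ^ 2 * p ^ 2 * g - 2 * Ψ * p * g * X + g ^ 2 * S)
    (hH : Z ≤ 4 * g * H) (hX : X ^ 2 ≤ S * g) (hR : -κ * g ≤ Rc)
    (hL : g * Λ + 2 * Y + Ψ * (2 * H + 2 * Rc) ≤ 0) :
    Ψ ^ 2 * p ≤ u * (10 * S + 8 * κ * Ψ ^ 2 - 4 * Ψ * Λ) := by
  have hp0 : 0 < p := by
    by_contra h
    push Not at h
    nlinarith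
  have h1 : 2 * g * Ψ * (g * Λ + 2 * Y + Ψ * (2 * H + 2 * Rc)) ≤ 0 :=
    mul_nonpos_of_nonneg_of_nonpos (by positivity) hL
  have h2 : Ψ ^ 2 * Z ≤ Ψ ^ 2 * (4 * g * H) := by gcongr
  have h3 : 4 * g * Ψ ^ 2 * (-κ * g) ≤ 4 * g * Ψ ^ 2 * Rc := by gcongr
  have h4 : 4 * g * (Ψ * Y) = 4 * g * (Ψ * p * X - g * S) := by rw [hY]
  have h5 : g * (2 * g * Ψ * Λ + 2 * Ψ * p * X - 3 * g * S + Ψ ^ 2 * p ^ 2 - 4 * κ * g * Ψ ^ 2)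
      ≤ 0 := by nlinarith
  have h6 : 2 * g * Ψ * Λ + 2 * Ψ * p * X - 3 * g * S + Ψ ^ 2 * p ^ 2 - 4 * κ * g * Ψ ^ 2 ≤ 0 := by
    by_contra h
    push Not at h
    have := mul_pos hg h
    linarith
  have h7 : Ψ ^ 2 * p ^ 2 ≤ g * (10 * S + 8 * κ * Ψ ^ 2 - 4 * Ψ * Λ) := by
    nlinarith [sq_nonneg (Ψ * p + 2 * X)]
  have h8 : p * (Ψ ^ 2 * p) ≤ p * (u * (10 * S + 8 * κ * Ψ ^ 2 - 4 * Ψ * Λ)) := by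
    rw [← hp] at h7; linarith
  exact le_of_mul_le_mul_left h8 hp0

lemma max_point_ineq {W : Type*} [NormedAddCommGroup W] [NormedSpace ℝ W] {n : ℕ}
    (e : Fin n → W) (θ : W) (U F Ψ : W → ℝ) (p : W) (κ : ℝ)
    (hU : Sm U p) (hF : Sm F p) (hΨ : Sm Ψ p)
    (hpde : ∀ᶠ q in nhds p, DD θ U q
      = ∑ i, DD (e i) (DD (e i) U) q - ∑ i, DD (e i) F q * DD (e i) U q)
    (hUp : 0 < U p) (hΨp : 0 < Ψ p)
    (hgp : 0 < ∑ i, DD (e i) U p * DD (e i) U p)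
    (hRic : -κ * (∑ i, DD (e i) U p * DD (e i) U p) ≤
      ∑ i, ∑ j, DD (e i) (DD (e j) F) p * DD (e i) U p * DD (e j) U p)
    (M : ℝ) (hM : M * U p = Ψ p * ∑ i, DD (e i) U p * DD (e i) U p)
    (hmax : ∀ k, IsLocalMax (fun s : ℝ => (fun q => Ψ q * (∑ i, DD (e i) U q * DD (e i) U q)
      - M * U q) (p + s • e k)) 0)
    (hleft : ∀ᶠ s : ℝ in nhdsWithin 0 (Iio 0), (fun q => Ψ q * (∑ i, DD (e i) U q * DD (e i) U q)
      - M * U q) (p + s • θ) ≤ (fun q => Ψ q * (∑ i, DD (e i) U q * DD (e i) U q)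
      - M * U q) p) :
    Ψ p * M ≤ U p * (10 * (∑ k, DD (e k) Ψ p ^ 2) + 8 * κ * Ψ p ^ 2
      - 4 * Ψ p * (∑ k, DD (e k) (DD (e k) Ψ) p - ∑ k, DD (e k) F p * DD (e k) Ψ p
        - DD θ Ψ p)) := by
  set G : W → ℝ := fun q => ∑ i, DD (e i) U q * DD (e i) U q with hG
  have hGs : Sm G p := Sm.sum fun i _ => (hU.D _).mul (hU.D _)
  have hMU : Sm (fun q => M * U q) p := (Sm.const M p).mul hU
  set N : W → ℝ := fun q => Ψ q * G q - M * U q with hN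
  have hNs : Sm N p := (hΨ.mul hGs).sub hMU
  -- derivatives of G
  have G1 : ∀ v, DD v G p = ∑ i, 2 * (DD (e i) U p * DD v (DD (e i) U) p) := by
    intro v
    rw [hG, DD_sum (fun i _ => ((hU.D _).mul (hU.D _)).diff)]
    refine Finset.sum_congr rfl fun i _ => ?_
    rw [DD_mul (hU.D _).diff (hU.D _).diff]; ring
  have G2 : ∀ v, DD v (DD v G) p = ∑ i, (2 * (DD v (DD (e i) U) p) ^ 2
      + 2 * (DD (e i) U p * DD v (DD v (DD (e i) U)) p)) := by
    intro v
    rw [hG, DD_DD_sum (fun i _ => ((hU.D _).mul (hU.D _)))]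
    refine Finset.sum_congr rfl fun i _ => ?_
    rw [DD_DD_mul (hU.D _) (hU.D _)]; ring
  -- differentiated equation
  have hc : ∀ i, DD θ (DD (e i) U) p = ∑ j, DD (e j) (DD (e j) (DD (e i) U)) p
      - ∑ j, (DD (e i) (DD (e j) F) p * DD (e j) U p
        + DD (e j) F p * DD (e j) (DD (e i) U) p) := by
    intro i
    rw [DD_comm hU, DD_congr (e i) (h := fun q => ∑ i, DD (e i) (DD (e i) U) q
      - ∑ i, DD (e i) F q * DD (e i) U q) hpde,
      DD_sub (Sm.sum fun j _ => ((hU.D _).D _)).diff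
        (Sm.sum fun j _ => ((hF.D _).mul (hU.D _))).diff,
      DD_sum fun j _ => ((hU.D _).D _).diff, DD_sum fun j _ => ((hF.D _).mul (hU.D _)).diff]
    congr 1
    · refine Finset.sum_congr rfl fun j _ => ?_
      rw [DD_comm (hU.D _)]
      refine DD_congr _ ?_
      have h2 : ContDiffAt ℝ 2 U p :=
        ContDiffAt.of_le hU two_le_smooth
      filter_upwards [h2.eventually (by simp)] with q hq
      exact DD_comm2 hq _ _
    · refine Finset.sum_congr rfl fun j _ => ?_
      rw [DD_mul (hF.D _).diff (hU.D _).diff, DD_comm hU (e i) (e j)]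
      ring
  -- first order condition
  have N1 : ∀ k, DD (e k) Ψ p * G p + Ψ p * DD (e k) G p = M * DD (e k) U p := by
    intro k
    have h1 := DD_zero_of_max hNs (hmax k)
    rw [hN, DD_sub (hΨ.mul hGs).diff hMU.diff, DD_mul hΨ.diff hGs.diff,
      DD_mul (Sm.const M p).diff hU.diff, DD_const] at h1
    linarith
  have N2 : ∀ k, Ψ p * DD (e k) (DD (e k) G) p + 2 * (DD (e k) Ψ p * DD (e k) G p)
      + G p * DD (e k) (DD (e k) Ψ) p - M * DD (e k) (DD (e k) U) p ≤ 0 := by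
    intro k
    have h1 := DD_DD_nonpos_of_max hNs (hmax k)
    rw [hN, DD_DD_sub (hΨ.mul hGs) hMU, DD_DD_mul hΨ hGs, DD_DD_mul (Sm.const M p) hU, DD_const]
      at h1
    have : DD (e k) (DD (e k) (fun _ : W => M)) p = 0 := by
      have : DD (e k) (fun _ : W => M) = fun _ => 0 := by funext q; exact DD_const _ _ _
      rw [this, DD_const]
    rw [this] at h1
    linarith
  have Nt : 0 ≤ Ψ p * DD θ G p + G p * DD θ Ψ p - M * DD θ U p := by
    have h1 := DD_nonneg_of_left hNs hleft
    rw [hN, DD_sub (hΨ.mul hGs).diff hMU.diff, DD_mul hΨ.diff hGs.diff,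
      DD_mul (Sm.const M p).diff hU.diff, DD_const] at h1
    linarith
  have hpde0 := hpde.self_of_nhds
  have hGp : 0 < G p := hgp
  -- abbreviations
  have hp' : (G p / U p) * U p = G p := by field_simp
  have hMeq : M = Ψ p * (G p / U p) := by
    have : M * U p = Ψ p * (G p / U p) * U p := by rw [hM, mul_assoc, hp']
    exact mul_right_cancel₀ hUp.ne' this
  set P := G p / U p with hP
  have gk : ∀ k, Ψ p * DD (e k) G p = Ψ p * P * DD (e k) U p - G p * DD (e k) Ψ p := by
    intro k; have := N1 k; rw [hMeq] at this; linarith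
  have hmain := scalar_core (u := U p) (g := G p) (Ψ := Ψ p) (κ := κ)
    (S := ∑ k, DD (e k) Ψ p ^ 2) (X := ∑ k, DD (e k) Ψ p * DD (e k) U p)
    (Y := ∑ k, DD (e k) Ψ p * DD (e k) G p) (Z := ∑ k, DD (e k) G p ^ 2)
    (H := ∑ k, ∑ i, DD (e k) (DD (e i) U) p ^ 2)
    (Rc := ∑ i, ∑ j, DD (e i) (DD (e j) F) p * DD (e i) U p * DD (e j) U p)
    (Λ := ∑ k, DD (e k) (DD (e k) Ψ) p - ∑ k, DD (e k) F p * DD (e k) Ψ p - DD θ Ψ p)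
    (p := P) hUp hGp hΨp hp' ?_ ?_ ?_ ?_ hRic ?_
  · calc Ψ p * M = Ψ p ^ 2 * P := by rw [hMeq]; ring
      _ ≤ _ := hmain
  · rw [Finset.mul_sum, Finset.mul_sum, Finset.mul_sum, ← Finset.sum_sub_distrib]
    refine Finset.sum_congr rfl fun k _ => ?_
    linear_combination (DD (e k) Ψ p) * gk k
  · have hGG : Ψ p ^ 2 * P ^ 2 * G p = ∑ k, Ψ p ^ 2 * P ^ 2 * (DD (e k) U p * DD (e k) U p) := by
      rw [← Finset.mul_sum]
    have hX : 2 * Ψ p * P * G p * ∑ k, DD (e k) Ψ p * DD (e k) U p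
        = ∑ k, 2 * Ψ p * P * G p * (DD (e k) Ψ p * DD (e k) U p) := Finset.mul_sum _ _ _
    have hSS : G p ^ 2 * ∑ k, DD (e k) Ψ p ^ 2 = ∑ k, G p ^ 2 * DD (e k) Ψ p ^ 2 :=
      Finset.mul_sum _ _ _
    have hZZ : Ψ p ^ 2 * ∑ k, DD (e k) G p ^ 2 = ∑ k, Ψ p ^ 2 * DD (e k) G p ^ 2 :=
      Finset.mul_sum _ _ _
    rw [hGG, hX, hSS, hZZ, ← Finset.sum_sub_distrib,
      ← Finset.sum_add_distrib]
    refine Finset.sum_congr rfl fun k _ => ?_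
    have : Ψ p ^ 2 * DD (e k) G p ^ 2 = (Ψ p * DD (e k) G p) ^ 2 := by ring
    rw [this, gk k]; ring
  · rw [Finset.mul_sum]
    refine Finset.sum_le_sum fun k _ => ?_
    rw [G1, ← Finset.mul_sum]
    have := Finset.sum_mul_sq_le_sq_mul_sq Finset.univ (fun i => DD (e i) U p)
      (fun i => DD (e k) (DD (e i) U) p)
    have hGG : G p = ∑ i, DD (e i) U p ^ 2 := by
      rw [hG]; exact Finset.sum_congr rfl fun i _ => by ring
    rw [hGG]; linarith
  · have := Finset.sum_mul_sq_le_sq_mul_sq Finset.univ (fun i => DD (e i) Ψ p)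
      (fun i => DD (e i) U p)
    have hGG : G p = ∑ i, DD (e i) U p ^ 2 := by
      rw [hG]; exact Finset.sum_congr rfl fun i _ => by ring
    rw [hGG]; exact this
  · -- the operator inequality
    have s2 := Finset.sum_nonpos (s := Finset.univ) fun k _ => N2 k
    rw [Finset.sum_sub_distrib, Finset.sum_add_distrib, Finset.sum_add_distrib,
      ← Finset.mul_sum, ← Finset.mul_sum, ← Finset.mul_sum, ← Finset.mul_sum] at s2
    have s1 : (∑ k, DD (e k) F p * DD (e k) Ψ p) * G p + Ψ p * ∑ k, DD (e k) F p * DD (e k) G p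
        = M * ∑ k, DD (e k) F p * DD (e k) U p := by
      rw [Finset.sum_mul, Finset.mul_sum, Finset.mul_sum, ← Finset.sum_add_distrib]
      refine Finset.sum_congr rfl fun k _ => ?_
      linear_combination (DD (e k) F p) * N1 k
    have hLG : ∑ k, DD (e k) (DD (e k) G) p - ∑ k, DD (e k) F p * DD (e k) G p - DD θ G p
        = 2 * (∑ k, ∑ i, DD (e k) (DD (e i) U) p ^ 2)
          + 2 * ∑ i, ∑ j, DD (e i) (DD (e j) F) p * DD (e i) U p * DD (e j) U p := by
      have a1 : ∑ k, DD (e k) (DD (e k) G) p = 2 * (∑ k, ∑ i, DD (e k) (DD (e i) U) p ^ 2)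
          + ∑ i, 2 * (DD (e i) U p * ∑ k, DD (e k) (DD (e k) (DD (e i) U)) p) := by
        simp_rw [G2, Finset.sum_add_distrib, Finset.mul_sum]
        congr 1
        exact Finset.sum_comm
      have a2 : ∑ k, DD (e k) F p * DD (e k) G p
          = ∑ i, 2 * (DD (e i) U p * ∑ k, DD (e k) F p * DD (e k) (DD (e i) U) p) := by
        simp_rw [G1, Finset.mul_sum]
        rw [Finset.sum_comm]
        refine Finset.sum_congr rfl fun i _ => Finset.sum_congr rfl fun k _ => by ring
      have a3 : ∑ i, ∑ j, DD (e i) (DD (e j) F) p * DD (e i) U p * DD (e j) U p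
          = ∑ i, DD (e i) U p * ∑ j, DD (e i) (DD (e j) F) p * DD (e j) U p := by
        simp_rw [Finset.mul_sum]
        refine Finset.sum_congr rfl fun i _ => Finset.sum_congr rfl fun k _ => by ring
      rw [a1, a2, a3, G1, Finset.mul_sum (a := (2:ℝ)) (s := Finset.univ)
        (f := fun i => DD (e i) U p * ∑ j, DD (e i) (DD (e j) F) p * DD (e j) U p),
        add_sub_assoc, add_sub_assoc, ← Finset.sum_sub_distrib,
        ← Finset.sum_sub_distrib]
      congr 1
      refine Finset.sum_congr rfl fun i _ => ?_
      rw [hc i, Finset.sum_add_distrib]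
      ring
    rw [← hLG]
    linear_combination s2 + Nt - s1 - M * hpde0

lemma inner_gradient_eq {n : ℕ} (f : EuclideanSpace ℝ (Fin n) → ℝ)
    (x v : EuclideanSpace ℝ (Fin n)) : ⟪gradient f x, v⟫ = DD v f x := by
  simp [gradient, DD]

lemma radial_comparison {n : ℕ} (hn : 1 ≤ n) {f : EuclideanSpace ℝ (Fin n) → ℝ}
    {x₀ x : EuclideanSpace ℝ (Fin n)} {R K : ℝ} (hf : ContDiff ℝ (⊤ : ℕ∞) f) (hK : 0 ≤ K)
    (hH : ∀ x ∈ ball x₀ R, ∀ v : EuclideanSpace ℝ (Fin n),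
          hessQF f x v ≥ -((n : ℝ) - 1) * K * ‖v‖ ^ 2)
    (hx : x ∈ ball x₀ R) (hr : 1 ≤ ‖x - x₀‖) :
    (n : ℝ) - 1 - DD (x - x₀) f x
      ≤ ‖x - x₀‖ * |alphaC f x₀| + ((n : ℝ) - 1) * K * ‖x - x₀‖ ^ 2 := by
  set v := x - x₀ with hv
  set r := ‖v‖ with hrdef
  have hr0 : 0 < r := by linarith
  have hn1 : (0 : ℝ) ≤ (n : ℝ) - 1 := by
    have : (1 : ℝ) ≤ n := by exact_mod_cast hn
    linarith
  have hsm : ∀ y, Sm f y := fun y => hf.contDiffAt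
  have hder : ∀ s : ℝ, HasDerivAt (fun s : ℝ => DD v f (x₀ + s • v))
      (DD v (DD v f) (x₀ + s • v)) s := fun s => DD_line ((hsm _).D v).diff
  have hmvt := Convex.mul_sub_le_image_sub_of_le_deriv (convex_Icc (0 : ℝ) 1)
    (f := fun s : ℝ => DD v f (x₀ + s • v))
    (fun s _ => (hder s).continuousAt.continuousWithinAt)
    (fun s _ => (hder s).differentiableAt.differentiableWithinAt)
    (C := -((n : ℝ) - 1) * K * r ^ 2) (by
      intro s hs
      rw [interior_Icc] at hs
      rw [(hder s).deriv]
      refine hH _ ?_ v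
      rw [mem_ball, dist_eq_norm] at hx ⊢
      rw [add_sub_cancel_left, norm_smul, Real.norm_eq_abs, abs_of_pos hs.1]
      have : s * ‖v‖ ≤ 1 * ‖v‖ := by gcongr; exact hs.2.le
      linarith)
    (1 / r) ⟨by positivity, by rw [div_le_one hr0]; exact hr⟩ 1 (by simp)
    (by rw [div_le_one hr0]; exact hr)
  have hx1 : x₀ + (1 : ℝ) • v = x := by simp [hv]
  simp only [hx1] at hmvt
  have hα : (n : ℝ) - 1 - ⟪gradient f (x₀ + (1 / r) • v), (1 / r) • v⟫ ≤ alphaC f x₀ := by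
    unfold alphaC
    refine le_csSup ?_ ⟨x₀ + (1 / r) • v, ?_, by simp⟩
    · refine (IsCompact.image (isCompact_sphere x₀ 1) ?_).bddAbove
      have h1 : Continuous fun y => DD (y - x₀) f y := by
        have : Continuous (fderiv ℝ f) := hf.continuous_fderiv (by simp)
        exact this.clm_apply (by fun_prop)
      simp_rw [inner_gradient_eq]
      exact continuous_const.sub h1
    · rw [mem_sphere, dist_eq_norm, add_sub_cancel_left, norm_smul, Real.norm_eq_abs,
        abs_of_pos (by positivity), ← hrdef]
      field_simp
  rw [inner_gradient_eq] at hα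
  have hlin : DD ((1 / r) • v) f (x₀ + (1 / r) • v) = (1 / r) * DD v f (x₀ + (1 / r) • v) := by
    simp [DD]
  rw [hlin] at hα
  set h1 := DD v f (x₀ + (1 / r) • v)
  have hα2 : r * ((n : ℝ) - 1) - h1 ≤ r * |alphaC f x₀| := by
    have := mul_le_mul_of_nonneg_left (hα.trans (le_abs_self _)) hr0.le
    have e : r * ((n : ℝ) - 1 - 1 / r * h1) = r * ((n : ℝ) - 1) - h1 := by field_simp
    rwa [e] at this
  have h3 : ((n : ℝ) - 1) * K * r ^ 2 * (1 - 1 / r) ≤ ((n : ℝ) - 1) * K * r ^ 2 * 1 := by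
    refine mul_le_mul_of_nonneg_left ?_ (by positivity)
    have : 0 < 1 / r := by positivity
    linarith
  have h4 : ((n : ℝ) - 1) * 1 ≤ ((n : ℝ) - 1) * r := by gcongr
  linarith

/-- one-dimensional cutoff profile -/
def chi (s : ℝ) : ℝ := Real.smoothTransition (2 - 4 * s) ^ 2

lemma chi_smooth : ContDiff ℝ (⊤ : ℕ∞) chi := by
  unfold chi
  exact (Real.smoothTransition.contDiff.comp (by fun_prop)).pow 2

lemma chi_one {s : ℝ} (h : s ≤ 1 / 4) : chi s = 1 := by
  unfold chi; rw [Real.smoothTransition.one_of_one_le (by linarith)]; norm_num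

lemma chi_zero {s : ℝ} (h : 1 / 2 ≤ s) : chi s = 0 := by
  unfold chi; rw [Real.smoothTransition.zero_of_nonpos (by linarith)]; norm_num

lemma chi_nonneg (s : ℝ) : 0 ≤ chi s := by unfold chi; positivity

lemma chi_le_one (s : ℝ) : chi s ≤ 1 := by
  unfold chi
  exact pow_le_one₀ (Real.smoothTransition.nonneg _) (Real.smoothTransition.le_one _)

lemma chi_anti : Antitone chi := by
  intro a b h
  unfold chi
  gcongr
  · exact Real.smoothTransition.nonneg _
  · exact Real.smoothTransition.monotone (by linarith)

lemma chi_deriv_nonpos (s : ℝ) : deriv chi s ≤ 0 := chi_anti.deriv_nonpos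

lemma chi_deriv_zero {s : ℝ} (h : s < 1 / 4) : deriv chi s = 0 := by
  have : chi =ᶠ[nhds s] fun _ => 1 := by
    filter_upwards [Iio_mem_nhds h] with y hy
    exact chi_one (le_of_lt hy)
  rw [this.deriv_eq]; simp

lemma chi_bounds : ∃ C : ℝ, 0 < C ∧ ∀ s ∈ Icc (0 : ℝ) 1,
    |deriv chi s| ≤ C ∧ |deriv (deriv chi) s| ≤ C ∧ deriv chi s ^ 2 ≤ C * chi s := by
  have h1 : ContDiff ℝ (⊤ : ℕ∞) (deriv chi) := by
    have := (contDiff_infty_iff_deriv (𝕜 := ℝ) (f := chi)).1 chi_smooth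
    exact this.2
  have h2 : ContDiff ℝ (⊤ : ℕ∞) (deriv (deriv chi)) :=
    ((contDiff_infty_iff_deriv (𝕜 := ℝ) (f := deriv chi)).1 h1).2
  have hη : ContDiff ℝ (⊤ : ℕ∞) (fun s : ℝ => Real.smoothTransition (2 - 4 * s)) :=
    Real.smoothTransition.contDiff.comp (by fun_prop)
  have h3 : ContDiff ℝ (⊤ : ℕ∞) (deriv (fun s : ℝ => Real.smoothTransition (2 - 4 * s))) :=
    ((contDiff_infty_iff_deriv (𝕜 := ℝ)).1 hη).2
  obtain ⟨C1, hC1⟩ := isCompact_Icc.exists_bound_of_continuousOn (s := Icc (0 : ℝ) 1)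
    h1.continuous.continuousOn
  obtain ⟨C2, hC2⟩ := isCompact_Icc.exists_bound_of_continuousOn (s := Icc (0 : ℝ) 1)
    h2.continuous.continuousOn
  obtain ⟨C3, hC3⟩ := isCompact_Icc.exists_bound_of_continuousOn (s := Icc (0 : ℝ) 1)
    h3.continuous.continuousOn
  refine ⟨|C1| + |C2| + 4 * C3 ^ 2 + 1, by positivity, fun s hs => ⟨?_, ?_, ?_⟩⟩
  · have := hC1 s hs
    rw [Real.norm_eq_abs] at this
    nlinarith [le_abs_self C1, abs_nonneg C2, sq_nonneg C3]
  · have := hC2 s hs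
    rw [Real.norm_eq_abs] at this
    nlinarith [le_abs_self C2, abs_nonneg C1, sq_nonneg C3]
  · have h := hC3 s hs
    rw [Real.norm_eq_abs] at h
    have hd : deriv chi s = 2 * Real.smoothTransition (2 - 4 * s)
        * deriv (fun s : ℝ => Real.smoothTransition (2 - 4 * s)) s := by
      have := ((hη.differentiable (by simp) s).hasDerivAt.pow 2).deriv
      change deriv (fun s => Real.smoothTransition (2 - 4 * s) ^ 2) s = _
      simpa [Pi.pow_def] using this
    have hsq : deriv (fun s : ℝ => Real.smoothTransition (2 - 4 * s)) s ^ 2 ≤ C3 ^ 2 :=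
      sq_le_sq.2 (h.trans (le_abs_self _))
    have e : deriv chi s ^ 2 = 4 * chi s
        * deriv (fun s : ℝ => Real.smoothTransition (2 - 4 * s)) s ^ 2 := by
      rw [hd]; unfold chi; ring
    rw [e]
    have h0 := chi_nonneg s
    calc 4 * chi s * deriv (fun s : ℝ => Real.smoothTransition (2 - 4 * s)) s ^ 2
        ≤ 4 * chi s * C3 ^ 2 := by gcongr
      _ ≤ (|C1| + |C2| + 4 * C3 ^ 2 + 1) * chi s := by
        nlinarith [abs_nonneg C1, abs_nonneg C2]

lemma cutoff_exists (n : ℕ) (hn : 1 ≤ n) : ∃ C : ℝ, 0 < C ∧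
    ∀ (f : EuclideanSpace ℝ (Fin n) → ℝ) (x₀ : EuclideanSpace ℝ (Fin n)) (R K : ℝ),
    ContDiff ℝ (⊤ : ℕ∞) f → 2 ≤ R → 0 ≤ K →
    (∀ x ∈ ball x₀ R, ∀ v : EuclideanSpace ℝ (Fin n),
          hessQF f x v ≥ -((n : ℝ) - 1) * K * ‖v‖ ^ 2) →
    ∃ φ : EuclideanSpace ℝ (Fin n) → ℝ, ContDiff ℝ (⊤ : ℕ∞) φ ∧ (∀ x, 0 ≤ φ x) ∧
      (∀ x, φ x ≤ 1) ∧ (∀ x ∈ ball x₀ (R / 2), φ x = 1) ∧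
      (∀ x, 3 * R / 4 ≤ ‖x - x₀‖ → φ x = 0) ∧
      (∀ x ∈ ball x₀ R, ∑ i, DD (EuclideanSpace.single i 1) φ x ^ 2 ≤ C * φ x / R ^ 2) ∧
      (∀ x ∈ ball x₀ R, -(C * (1 / R ^ 2 + |alphaC f x₀| / R + K)) ≤
        ∑ i, DD (EuclideanSpace.single i 1) (DD (EuclideanSpace.single i 1) φ) x
          - ∑ i, DD (EuclideanSpace.single i 1) f x * DD (EuclideanSpace.single i 1) φ x) := by
  obtain ⟨C, hC, hb⟩ := chi_bounds
  refine ⟨(6 + 2 * n) * C, by positivity, ?_⟩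
  intro f x₀ R K hf hR hK hH
  have hR0 : 0 < R := by linarith
  set σ : EuclideanSpace ℝ (Fin n) → ℝ := fun x => ‖x - x₀‖ ^ 2 / R ^ 2 with hσ
  have hσs : ContDiff ℝ (⊤ : ℕ∞) σ := by
    have : ContDiff ℝ (⊤ : ℕ∞) fun x : EuclideanSpace ℝ (Fin n) => x - x₀ :=
      contDiff_id.sub contDiff_const
    exact (this.norm_sq ℝ).div_const _
  have hσ1 : ∀ x v, DD v σ x = 2 * ⟪x - x₀, v⟫ / R ^ 2 := by
    intro x v
    have h1 : HasFDerivAt (fun x : EuclideanSpace ℝ (Fin n) => x - x₀)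
      (ContinuousLinearMap.id ℝ _) x := (hasFDerivAt_id x).sub_const x₀
    have h2 := (h1.norm_sq).mul_const (R ^ 2)⁻¹
    have h3 : fderiv ℝ σ x = _ := h2.fderiv
    unfold DD
    rw [h3]
    simp
    field_simp
    rw [inner_sub_left]
  have hσ2 : ∀ x v, DD v (DD v σ) x = 2 * ⟪v, v⟫ / R ^ 2 := by
    intro x v
    have : DD v σ = fun x => 2 * ⟪x - x₀, v⟫ / R ^ 2 := funext fun x => hσ1 x v
    rw [this]
    have h1 : HasFDerivAt (fun x : EuclideanSpace ℝ (Fin n) => x - x₀)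
      (ContinuousLinearMap.id ℝ _) x := (hasFDerivAt_id x).sub_const x₀
    have h2 := ((h1.inner ℝ (hasFDerivAt_const v x)).const_mul 2).mul_const (R ^ 2)⁻¹
    have h3 : fderiv ℝ (fun x => 2 * ⟪x - x₀, v⟫ / R ^ 2) x = _ := h2.fderiv
    unfold DD
    rw [h3]
    simp
    field_simp
  have hcomp : ∀ (g : ℝ → ℝ), Differentiable ℝ g → ∀ x v,
      DD v (fun y => g (σ y)) x = deriv g (σ x) * DD v σ x := by
    intro g hg x v
    have hs : DifferentiableAt ℝ σ x := hσs.differentiable (by simp) x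
    have := ((hg (σ x)).hasDerivAt.comp_hasFDerivAt x hs.hasFDerivAt).fderiv
    change fderiv ℝ (g ∘ σ) x v = _
    rw [this]; simp [DD]
  have hd1 : ContDiff ℝ (⊤ : ℕ∞) (deriv chi) :=
    ((contDiff_infty_iff_deriv (𝕜 := ℝ) (f := chi)).1 chi_smooth).2
  have hφ1 : ∀ x v, DD v (fun y => chi (σ y)) x = deriv chi (σ x) * (2 * ⟪x - x₀, v⟫ / R ^ 2) := by
    intro x v
    rw [hcomp _ (chi_smooth.differentiable (by simp)), hσ1]
  have hφ2 : ∀ x v, DD v (DD v (fun y => chi (σ y))) x =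
      deriv (deriv chi) (σ x) * (2 * ⟪x - x₀, v⟫ / R ^ 2) ^ 2
        + deriv chi (σ x) * (2 * ⟪v, v⟫ / R ^ 2) := by
    intro x v
    have e : DD v (fun y => chi (σ y)) = fun y => deriv chi (σ y) * DD v σ y :=
      funext fun y => hcomp _ (chi_smooth.differentiable (by simp)) y v
    have s1 : Sm (fun y => deriv chi (σ y)) x := (hd1.comp hσs).contDiffAt
    have s2 : Sm σ x := hσs.contDiffAt
    rw [e, DD_mul s1.diff (s2.D v).diff, hcomp _ (hd1.differentiable (by simp)), hσ2, hσ1]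
    ring
  have hsum : ∀ x, ∑ i : Fin n, ⟪x - x₀, EuclideanSpace.single i (1 : ℝ)⟫ ^ 2 = ‖x - x₀‖ ^ 2 := by
    intro x
    rw [EuclideanSpace.norm_sq_eq]
    refine Finset.sum_congr rfl fun i _ => ?_
    simp [EuclideanSpace.inner_single_right]
  have hσm : ∀ x ∈ ball x₀ R, σ x ∈ Icc (0 : ℝ) 1 := by
    intro x hx
    rw [mem_ball, dist_eq_norm] at hx
    refine ⟨by positivity, ?_⟩
    simp only [hσ]
    rw [div_le_one (by positivity)]
    gcongr
  refine ⟨fun y => chi (σ y), chi_smooth.comp hσs, fun x => chi_nonneg _, fun x => chi_le_one _,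
    ?_, ?_, ?_, ?_⟩
  · intro x hx
    rw [mem_ball, dist_eq_norm] at hx
    refine chi_one ?_
    simp only [hσ]
    rw [div_le_iff₀ (by positivity)]
    nlinarith [norm_nonneg (x - x₀)]
  · intro x hx
    refine chi_zero ?_
    simp only [hσ]
    rw [le_div_iff₀ (by positivity)]
    nlinarith [norm_nonneg (x - x₀)]
  · intro x hx
    obtain ⟨-, -, h3⟩ := hb _ (hσm x hx)
    have hs := hσm x hx
    have e : ∑ i : Fin n, DD (EuclideanSpace.single i 1) (fun y => chi (σ y)) x ^ 2
        = deriv chi (σ x) ^ 2 * (4 * σ x) / R ^ 2 := by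
      simp_rw [hφ1]
      have : σ x = (∑ i : Fin n, ⟪x - x₀, EuclideanSpace.single i (1 : ℝ)⟫ ^ 2) / R ^ 2 := by
        rw [hsum]
      have e2 : deriv chi (σ x) ^ 2 * (4 * ((∑ i : Fin n,
          ⟪x - x₀, EuclideanSpace.single i (1 : ℝ)⟫ ^ 2) / R ^ 2)) / R ^ 2
          = ∑ i : Fin n, (deriv chi (σ x) ^ 2 * 4 / R ^ 2 / R ^ 2)
            * ⟪x - x₀, EuclideanSpace.single i (1 : ℝ)⟫ ^ 2 := by
        rw [← Finset.mul_sum]; ring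
      rw [← this] at e2
      rw [e2]
      refine Finset.sum_congr rfl fun i _ => ?_
      ring
    rw [e]
    refine div_le_div_of_nonneg_right ?_ (by positivity)
    have hn0 : (0 : ℝ) ≤ n := by positivity
    have hc0 := chi_nonneg (σ x)
    calc deriv chi (σ x) ^ 2 * (4 * σ x) ≤ (C * chi (σ x)) * (4 * 1) := by
          have := hs.1
          have := hs.2
          gcongr
      _ ≤ (6 + 2 * n) * C * chi (σ x) := by
          have : 0 ≤ C * chi (σ x) := by positivity
          nlinarith
  · intro x hx
    obtain ⟨h1, h2, -⟩ := hb _ (hσm x hx)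
    have hs := hσm x hx
    have eS : (∑ i : Fin n, ⟪x - x₀, EuclideanSpace.single i (1 : ℝ)⟫ ^ 2) = σ x * R ^ 2 := by
      rw [hsum]; simp only [hσ]; field_simp
    have eF : ∑ i : Fin n, DD (EuclideanSpace.single i 1) f x
        * ⟪x - x₀, EuclideanSpace.single i (1 : ℝ)⟫ = DD (x - x₀) f x := by
      have hv : x - x₀ = ∑ i : Fin n, ⟪x - x₀, EuclideanSpace.single i (1 : ℝ)⟫
          • EuclideanSpace.single i (1 : ℝ) := by
        have := (EuclideanSpace.basisFun (Fin n) ℝ).sum_repr' (x - x₀)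
        simp only [EuclideanSpace.basisFun_apply] at this
        conv_lhs => rw [← this]
        refine Finset.sum_congr rfl fun i _ => ?_
        rw [real_inner_comm]
      have h5 : DD (x - x₀) f x = fderiv ℝ f x (∑ i : Fin n,
          ⟪x - x₀, EuclideanSpace.single i (1 : ℝ)⟫ • EuclideanSpace.single i (1 : ℝ)) := by
        rw [← hv]; rfl
      rw [h5, map_sum]
      refine Finset.sum_congr rfl fun i _ => ?_
      rw [map_smul, smul_eq_mul, mul_comm]; rfl
    have e1 : ∑ i : Fin n, DD (EuclideanSpace.single i 1)
        (DD (EuclideanSpace.single i 1) (fun y => chi (σ y))) x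
        = deriv (deriv chi) (σ x) * (4 * σ x) / R ^ 2 + deriv chi (σ x) * (2 * n) / R ^ 2 := by
      simp_rw [hφ2]
      rw [Finset.sum_add_distrib]
      congr 1
      · have : ∀ i : Fin n, deriv (deriv chi) (σ x)
            * (2 * ⟪x - x₀, EuclideanSpace.single i (1 : ℝ)⟫ / R ^ 2) ^ 2
            = (deriv (deriv chi) (σ x) * 4 / R ^ 4)
              * ⟪x - x₀, EuclideanSpace.single i (1 : ℝ)⟫ ^ 2 := by
          intro i; field_simp; ring
        rw [Finset.sum_congr rfl fun i _ => this i, ← Finset.mul_sum, eS]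
        field_simp
      · simp
        ring
    have e2 : ∑ i : Fin n, DD (EuclideanSpace.single i 1) f x
        * DD (EuclideanSpace.single i 1) (fun y => chi (σ y)) x
        = deriv chi (σ x) * (2 * DD (x - x₀) f x) / R ^ 2 := by
      simp_rw [hφ1]
      rw [← eF]
      have : ∀ i : Fin n, DD (EuclideanSpace.single i 1) f x * (deriv chi (σ x)
          * (2 * ⟪x - x₀, EuclideanSpace.single i (1 : ℝ)⟫ / R ^ 2))
          = (deriv chi (σ x) * 2 / R ^ 2) * (DD (EuclideanSpace.single i 1) f x
          * ⟪x - x₀, EuclideanSpace.single i (1 : ℝ)⟫) := fun i => by ring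
      rw [Finset.sum_congr rfl fun i _ => this i, ← Finset.mul_sum]
      ring
    rw [e1, e2]
    have hα : 0 ≤ |alphaC f x₀| := abs_nonneg _
    have hn0 : (1 : ℝ) ≤ n := by exact_mod_cast hn
    have hxR : ‖x - x₀‖ < R := by rwa [mem_ball, dist_eq_norm] at hx
    have k1 : deriv chi (σ x) * (2 * n - 2 * DD (x - x₀) f x)
        ≥ -(C * (2 + 2 * R * |alphaC f x₀| + 2 * n * K * R ^ 2)) := by
      have hQ : 0 ≤ 2 + 2 * R * |alphaC f x₀| + 2 * n * K * R ^ 2 := by positivity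
      by_cases hlt : σ x < 1 / 4
      · rw [chi_deriv_zero hlt]
        have := mul_nonneg hC.le hQ
        linarith
      · push Not at hlt
        have hr : 1 ≤ ‖x - x₀‖ := by
          simp only [hσ] at hlt
          rw [le_div_iff₀ (by positivity)] at hlt
          by_contra hcon
          push Not at hcon
          nlinarith [norm_nonneg (x - x₀)]
        have hrc := radial_comparison hn hf hK hH hx hr
        have a1 : ‖x - x₀‖ * |alphaC f x₀| ≤ R * |alphaC f x₀| := by gcongr
        have a2 : ((n : ℝ) - 1) * K * ‖x - x₀‖ ^ 2 ≤ n * K * R ^ 2 := by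
          gcongr
          linarith
        have a3 : 2 * n - 2 * DD (x - x₀) f x ≤ 2 + 2 * R * |alphaC f x₀| + 2 * n * K * R ^ 2 := by
          linarith
        have a4 := mul_le_mul_of_nonpos_left a3 (chi_deriv_nonpos (σ x))
        have a5 : -C ≤ deriv chi (σ x) := (abs_le.1 h1).1
        have a6 := mul_le_mul_of_nonneg_right a5 hQ
        linarith
    have k2 : deriv (deriv chi) (σ x) * (4 * σ x) ≥ -(C * 4) := by
      have a5 : -C ≤ deriv (deriv chi) (σ x) := (abs_le.1 h2).1
      have := hs.1
      have := hs.2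
      nlinarith
    have k3 : deriv (deriv chi) (σ x) * (4 * σ x) / R ^ 2 + deriv chi (σ x) * (2 * n) / R ^ 2
        - deriv chi (σ x) * (2 * DD (x - x₀) f x) / R ^ 2
        = (deriv (deriv chi) (σ x) * (4 * σ x)
          + deriv chi (σ x) * (2 * n - 2 * DD (x - x₀) f x)) / R ^ 2 := by ring
    rw [k3, le_div_iff₀ (by positivity)]
    have k4 : -((6 + 2 * n) * C * (1 / R ^ 2 + |alphaC f x₀| / R + K)) * R ^ 2
        = -((6 + 2 * n) * C * (1 + R * |alphaC f x₀| + K * R ^ 2)) := by field_simp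
    rw [k4]
    have : 0 ≤ C * (R * |alphaC f x₀|) := by positivity
    have : 0 ≤ C * (K * R ^ 2) := by positivity
    nlinarith [mul_nonneg (by linarith : (0:ℝ) ≤ n) (by positivity : 0 ≤ C * (R * |alphaC f x₀|))]

section Slices
variable {n : ℕ}

/-- spatial basis vectors in space-time -/
def ee (i : Fin n) : EuclideanSpace ℝ (Fin n) × ℝ := (EuclideanSpace.single i 1, 0)

/-- time direction -/
def th : EuclideanSpace ℝ (Fin n) × ℝ := (0, 1)

lemma slice_fderiv {g : EuclideanSpace ℝ (Fin n) × ℝ → ℝ} {x : EuclideanSpace ℝ (Fin n)} {t : ℝ}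
    (h : DifferentiableAt ℝ g (x, t)) (v : EuclideanSpace ℝ (Fin n)) :
    fderiv ℝ (fun y => g (y, t)) x v = DD (v, 0) g (x, t) := by
  have h1 : HasFDerivAt (fun y : EuclideanSpace ℝ (Fin n) => (y, t))
      (ContinuousLinearMap.inl ℝ _ _) x := hasFDerivAt_prodMk_left x t
  have := (h.hasFDerivAt.comp x h1).fderiv
  change fderiv ℝ (g ∘ fun y => (y, t)) x v = _
  rw [this]; simp [DD]

lemma slice_deriv {g : EuclideanSpace ℝ (Fin n) × ℝ → ℝ} {x : EuclideanSpace ℝ (Fin n)} {t : ℝ}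
    (h : DifferentiableAt ℝ g (x, t)) :
    deriv (fun s => g (x, s)) t = DD th g (x, t) := by
  have h1 : HasFDerivAt (fun s : ℝ => (x, s))
      (ContinuousLinearMap.inr ℝ _ _) t := hasFDerivAt_prodMk_right x t
  have := (h.hasFDerivAt.comp t h1).hasDerivAt.deriv
  change deriv (g ∘ fun s => (x, s)) t = _
  rw [this]; simp [DD, th]

lemma DD_fst {g : EuclideanSpace ℝ (Fin n) → ℝ} (p : EuclideanSpace ℝ (Fin n) × ℝ)
    (h : DifferentiableAt ℝ g p.1) (v : EuclideanSpace ℝ (Fin n) × ℝ) :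
    DD v (fun q => g q.1) p = DD v.1 g p.1 := by
  have := (h.hasFDerivAt.comp p hasFDerivAt_fst).fderiv
  change fderiv ℝ (g ∘ Prod.fst) p v = _
  rw [this]; simp [DD]

lemma inner_grad_grad (f g : EuclideanSpace ℝ (Fin n) → ℝ) (x : EuclideanSpace ℝ (Fin n)) :
    ⟪gradient f x, gradient g x⟫ = ∑ i : Fin n, DD (EuclideanSpace.single i 1) f x
      * DD (EuclideanSpace.single i 1) g x := by
  rw [← (EuclideanSpace.basisFun (Fin n) ℝ).sum_inner_mul_inner]
  refine Finset.sum_congr rfl fun i _ => ?_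
  rw [EuclideanSpace.basisFun_apply, real_inner_comm (gradient g x) (EuclideanSpace.single i 1),
    inner_gradient_eq, inner_gradient_eq]

lemma hess_expand {f : EuclideanSpace ℝ (Fin n) → ℝ} (hf : ContDiff ℝ (⊤ : ℕ∞) f)
    (x : EuclideanSpace ℝ (Fin n)) (a : Fin n → ℝ) :
    hessQF f x (∑ i, a i • EuclideanSpace.single i (1 : ℝ))
      = ∑ i, ∑ j, DD (EuclideanSpace.single i 1) (DD (EuclideanSpace.single j 1) f) x
        * a i * a j := by
  have h1 : ContDiff ℝ (⊤ : ℕ∞) (fderiv ℝ f) := hf.fderiv_right (by simp)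
  have hd : DifferentiableAt ℝ (fderiv ℝ f) x := h1.differentiable (by simp) x
  have key : ∀ a b, DD a (DD b f) x = fderiv ℝ (fderiv ℝ f) x a b := by
    intro a b
    have := (hd.hasFDerivAt.clm_apply (hasFDerivAt_const b x)).fderiv
    change fderiv ℝ (fun q => fderiv ℝ f q b) x a = _
    rw [this]; simp
  change DD _ (DD _ f) x = _
  simp_rw [key]
  rw [map_sum, Finset.sum_comm]
  refine Finset.sum_congr rfl fun j _ => ?_
  rw [map_sum, sum_apply]
  refine Finset.sum_congr rfl fun i _ => ?_
  rw [map_smul, map_smul, smul_apply, smul_eq_mul, smul_eq_mul]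
  ring

lemma norm_sq_expand (a : Fin n → ℝ) :
    ‖∑ i, a i • EuclideanSpace.single i (1 : ℝ)‖ ^ 2 = ∑ i, a i * a i := by
  rw [EuclideanSpace.norm_sq_eq]
  refine Finset.sum_congr rfl fun i _ => ?_
  simp [Finset.sum_apply, Pi.single_apply, sq]

end Slices

lemma final_scalar {τ₁ τ φ S Λ κ N C R B D U M K : ℝ} (hτ : 0 < τ₁) (hττ : τ₁ ≤ τ) (hφ : 0 < φ)
    (hφ1 : φ ≤ 1) (hC : 0 < C) (hR : 0 < R) (hU : 0 < U) (hUD : U ≤ D) (hκ : 0 ≤ κ)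
    (hκN : κ ≤ N * K) (hB : 0 ≤ B) (hS : S ≤ C * φ / R ^ 2) (hΛ : -(C * B) ≤ Λ)
    (h : (τ₁ * φ) * M ≤ U * (10 * (τ₁ ^ 2 * S) + 8 * κ * (τ₁ * φ) ^ 2
      - 4 * (τ₁ * φ) * (τ₁ * Λ - φ))) :
    M ≤ D * (4 + τ * (10 * (C / R ^ 2) + 8 * (N * K) + 4 * (C * B))) := by
  have hpos : 0 < τ₁ * φ := by positivity
  have h1 : 10 * (τ₁ ^ 2 * S) ≤ 10 * (τ₁ ^ 2 * (C * φ / R ^ 2)) := by gcongr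
  have h2 : (τ₁ * φ) * M ≤ (τ₁ * φ) *
      (U * (10 * τ₁ * (C / R ^ 2) + 8 * κ * (τ₁ * φ) - 4 * (τ₁ * Λ - φ))) := by
    refine h.trans ?_
    have := mul_le_mul_of_nonneg_left h1 hU.le
    have e : U * (10 * (τ₁ ^ 2 * (C * φ / R ^ 2))) = (τ₁ * φ) * (U * (10 * τ₁ * (C / R ^ 2))) := by
      ring
    nlinarith
  have h3 := le_of_mul_le_mul_left h2 hpos
  have h4 : 10 * τ₁ * (C / R ^ 2) + 8 * κ * (τ₁ * φ) - 4 * (τ₁ * Λ - φ)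
      ≤ 4 + τ * (10 * (C / R ^ 2) + 8 * (N * K) + 4 * (C * B)) := by
    have hNK : 0 ≤ N * K := hκ.trans hκN
    have a1 : κ * (τ₁ * φ) ≤ (N * K) * (τ₁ * 1) := by gcongr
    have a2 : τ₁ * -(C * B) ≤ τ₁ * Λ := by gcongr
    have a3 : τ₁ * (10 * (C / R ^ 2) + 8 * (N * K) + 4 * (C * B))
      ≤ τ * (10 * (C / R ^ 2) + 8 * (N * K) + 4 * (C * B)) := by gcongr
    linarith
  have hNK : 0 ≤ N * K := hκ.trans hκN
  have h5 : 0 ≤ 4 + τ * (10 * (C / R ^ 2) + 8 * (N * K) + 4 * (C * B)) := by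
    have : 0 < τ := hτ.trans_le hττ
    positivity
  calc M ≤ _ := h3
    _ ≤ U * (4 + τ * (10 * (C / R ^ 2) + 8 * (N * K) + 4 * (C * B))) := by gcongr
    _ ≤ _ := by gcongr

lemma interior_estimate (n : ℕ) (hn : 1 ≤ n) :
    ∃ c : ℝ, 0 < c ∧
      ∀ (f : EuclideanSpace ℝ (Fin n) → ℝ) (x₀ : EuclideanSpace ℝ (Fin n))
        (R K t₀ T D : ℝ) (u : EuclideanSpace ℝ (Fin n) → ℝ → ℝ),
        ContDiff ℝ (⊤ : ℕ∞) f →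
        2 ≤ R → 0 ≤ K → 0 < T → 0 < D →
        (∀ x ∈ ball x₀ R, ∀ v : EuclideanSpace ℝ (Fin n),
          hessQF f x v ≥ -((n : ℝ) - 1) * K * ‖v‖ ^ 2) →
        ContDiffOn ℝ (⊤ : ℕ∞) (fun p : EuclideanSpace ℝ (Fin n) × ℝ => u p.1 p.2)
          (ball x₀ R ×ˢ Icc (t₀ - T) t₀) →
        (∀ x ∈ ball x₀ R, ∀ t ∈ Icc (t₀ - T) t₀, 0 < u x t ∧ u x t ≤ D) →
        (∀ x ∈ ball x₀ R, ∀ t ∈ Icc (t₀ - T) t₀,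
          deriv (fun s => u x s) t = fLap f (fun y => u y t) x) →
        ∀ x ∈ ball x₀ (R / 2), ∀ t ∈ Ioo (t₀ - T) t₀,
          ‖gradient (fun y => u y t) x‖ ^ 2 ≤ u x t * (D * (c *
              (1 / R ^ 2 + |alphaC f x₀| / R + 1 / (t - t₀ + T) + K))) := by
  obtain ⟨C, hC, hcut⟩ := cutoff_exists n hn
  refine ⟨8 + 14 * C + 8 * n, by positivity, ?_⟩
  intro f x₀ R K t₀ T D u hf hR hK hT hD hH hu hpos hpde x hx t ht
  obtain ⟨φ, hφs, hφ0, hφ1, hφone, hφzero, hφg, hφL⟩ := hcut f x₀ R K hf hR hK hH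
  have hR0 : 0 < R := by linarith
  have hn0 : (1 : ℝ) ≤ n := by exact_mod_cast hn
  set U : EuclideanSpace ℝ (Fin n) × ℝ → ℝ := fun p => u p.1 p.2 with hUdef
  set Ω : Set (EuclideanSpace ℝ (Fin n) × ℝ) := ball x₀ R ×ˢ Ioo (t₀ - T) t₀ with hΩ
  have hΩo : IsOpen Ω := isOpen_ball.prod isOpen_Ioo
  have hUs : ∀ p ∈ Ω, Sm U p := by
    intro p hp
    have : ContDiffOn ℝ (⊤ : ℕ∞) U Ω := hu.mono (prod_mono_right Ioo_subset_Icc_self)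
    exact this.contDiffAt (hΩo.mem_nhds hp)
  have hFs : ∀ p : EuclideanSpace ℝ (Fin n) × ℝ, Sm (fun q => f q.1) p := fun p =>
    (hf.comp contDiff_fst).contDiffAt
  have hfd : Differentiable ℝ f := hf.differentiable (by simp)
  have hφd : Differentiable ℝ φ := hφs.differentiable (by simp)
  -- slices
  have hsl : ∀ y s, (y, s) ∈ Ω → ∀ v, DD v (fun z => u z s) y = DD (v, 0) U (y, s) := by
    intro y s hys v
    exact slice_fderiv (g := U) (hUs _ hys).diff v
  have hgrad : ∀ y s, (y, s) ∈ Ω → ‖gradient (fun z => u z s) y‖ ^ 2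
      = ∑ i, DD (ee i) U (y, s) * DD (ee i) U (y, s) := by
    intro y s hys
    rw [← real_inner_self_eq_norm_sq, inner_grad_grad]
    simp_rw [hsl y s hys]; rfl
  have hpdeΩ : ∀ q ∈ Ω, DD th U q = ∑ i, DD (ee i) (DD (ee i) U) q
      - ∑ i, DD (ee i) (fun q => f q.1) q * DD (ee i) U q := by
    rintro ⟨y, s⟩ hq
    have h1 := hpde y hq.1 s (Ioo_subset_Icc_self hq.2)
    have h2 : deriv (fun s => u y s) s = DD th U (y, s) := slice_deriv (g := U) (hUs _ hq).diff
    rw [h2] at h1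
    rw [h1]
    unfold fLap
    congr 1
    · unfold eLap
      refine Finset.sum_congr rfl fun i _ => ?_
      have hev : ∀ᶠ z in nhds y, (z, s) ∈ Ω := by
        filter_upwards [isOpen_ball.mem_nhds hq.1] with z hz
        exact ⟨hz, hq.2⟩
      have e : (fun z => fderiv ℝ (fun y => u y s) z (EuclideanSpace.single i 1))
          =ᶠ[nhds y] fun z => DD (ee i) U (z, s) := by
        filter_upwards [hev] with z hz
        exact hsl z s hz _
      rw [e.fderiv_eq]
      exact slice_fderiv (g := DD (ee i) U) ((hUs _ hq).D _).diff _
    · rw [inner_grad_grad]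
      refine Finset.sum_congr rfl fun i _ => ?_
      rw [hsl y s hq, DD_fst _ (hfd _)]; rfl
  -- cutoff in space-time
  set s₀ : ℝ := (t₀ - T + t) / 2 with hs₀
  have hs1 : t₀ - T < s₀ := by have := ht.1; simp only [hs₀]; linarith
  have hs2 : s₀ < t := by have := ht.1; simp only [hs₀]; linarith
  set Ψ : EuclideanSpace ℝ (Fin n) × ℝ → ℝ := fun p => (p.2 - s₀) * φ p.1 with hΨ
  have htm : ∀ p : EuclideanSpace ℝ (Fin n) × ℝ, Sm (fun q => q.2 - s₀) p := fun p =>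
    (contDiff_snd.sub contDiff_const).contDiffAt
  have hφS : ∀ p : EuclideanSpace ℝ (Fin n) × ℝ, Sm (fun q => φ q.1) p := fun p =>
    (hφs.comp contDiff_fst).contDiffAt
  have hΨs : ∀ p, Sm Ψ p := fun p => (htm p).mul (hφS p)
  have htmD : ∀ (v p : EuclideanSpace ℝ (Fin n) × ℝ), DD v (fun q => q.2 - s₀) p = v.2 := by
    intro v p
    have : HasFDerivAt (fun q : EuclideanSpace ℝ (Fin n) × ℝ => q.2 - s₀)
      (ContinuousLinearMap.snd ℝ _ _) p := hasFDerivAt_snd.sub_const s₀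
    unfold DD; rw [this.fderiv]; rfl
  have hΨ1 : ∀ i p, DD (ee i) Ψ p = (p.2 - s₀) * DD (EuclideanSpace.single i 1) φ p.1 := by
    intro i p
    rw [hΨ, DD_mul (htm p).diff (hφS p).diff, htmD, DD_fst _ (hφd _)]
    simp [ee]
  have hΨ2 : ∀ i p, DD (ee i) (DD (ee i) Ψ) p = (p.2 - s₀)
      * DD (EuclideanSpace.single i 1) (DD (EuclideanSpace.single i 1) φ) p.1 := by
    intro i p
    have e : DD (ee i) Ψ = fun p => (p.2 - s₀) * DD (EuclideanSpace.single i 1) φ p.1 :=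
      funext fun p => hΨ1 i p
    have s1 : Sm φ p.1 := hφs.contDiffAt
    have s2 : Sm (fun q : EuclideanSpace ℝ (Fin n) × ℝ => DD (EuclideanSpace.single i 1) φ q.1) p :=
      ContDiffAt.comp p (s1.D _) contDiffAt_fst
    rw [e, DD_mul (htm p).diff s2.diff, htmD, DD_fst _ (s1.D _).diff]
    simp [ee]
  have hΨt : ∀ p, DD th Ψ p = φ p.1 := by
    intro p
    rw [hΨ, DD_mul (htm p).diff (hφS p).diff, htmD, DD_fst _ (hφd _)]
    simp [th, DD]
  set G : EuclideanSpace ℝ (Fin n) × ℝ → ℝ := fun q => ∑ i, DD (ee i) U q * DD (ee i) U q with hG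
  have hG0 : ∀ q, 0 ≤ G q := fun q => Finset.sum_nonneg fun i _ => mul_self_nonneg _
  have hGs : ∀ p ∈ Ω, Sm G p := fun p hp => Sm.sum fun i _ => ((hUs p hp).D _).mul ((hUs p hp).D _)
  have hUpos : ∀ p ∈ Ω, 0 < U p ∧ U p ≤ D := fun p hp =>
    hpos p.1 hp.1 p.2 (Ioo_subset_Icc_self hp.2)
  set Kc : Set (EuclideanSpace ℝ (Fin n) × ℝ) := closedBall x₀ (3 * R / 4) ×ˢ Icc s₀ t with hKc
  have hKΩ : Kc ⊆ Ω := by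
    refine prod_mono (closedBall_subset_ball (by linarith)) ?_
    intro s hs
    exact ⟨hs1.trans_le hs.1, hs.2.trans_lt ht.2⟩
  have hKcpt : IsCompact Kc := (isCompact_closedBall _ _).prod isCompact_Icc
  have hxt : (x, t) ∈ Kc := by
    refine ⟨?_, hs2.le, le_rfl⟩
    exact closedBall_subset_closedBall (by linarith) (ball_subset_closedBall hx)
  have hcont : ContinuousOn (fun p => Ψ p * G p / U p) Kc := by
    intro p hp
    have hpΩ := hKΩ hp
    exact (((hΨs p).diff.continuousAt.mul (hGs p hpΩ).diff.continuousAt).div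
      (hUs p hpΩ).diff.continuousAt (hUpos p hpΩ).1.ne').continuousWithinAt
  obtain ⟨p, hpK, hpmax⟩ := hKcpt.exists_isMaxOn ⟨_, hxt⟩ hcont
  have hpΩ := hKΩ hpK
  set M : ℝ := Ψ p * G p / U p with hM
  set B : ℝ := 1 / R ^ 2 + |alphaC f x₀| / R + K with hB
  have hB0 : 0 ≤ B := by positivity
  have hτ : 0 < t - s₀ := by linarith
  have hMbound : M ≤ D * (4 + (t - s₀) * (10 * (C / R ^ 2) + 8 * (n * K) + 4 * (C * B))) := by
    by_cases hM0 : M ≤ 0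
    · exact hM0.trans (by positivity)
    · push Not at hM0
      have hUp := hUpos p hpΩ
      have hMU : M * U p = Ψ p * G p := by
        rw [hM]; field_simp [hUp.1.ne']
      have hprod : 0 < Ψ p * G p := by rw [← hMU]; exact mul_pos hM0 hUp.1
      have hτp : 0 ≤ p.2 - s₀ := sub_nonneg.2 hpK.2.1
      have hΨ0 : 0 ≤ Ψ p := mul_nonneg hτp (hφ0 _)
      have hΨp : 0 < Ψ p := lt_of_le_of_ne hΨ0 (fun h => by rw [← h] at hprod; simp at hprod)
      have hGp : 0 < G p := lt_of_le_of_ne (hG0 p) (fun h => by rw [← h] at hprod; simp at hprod)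
      have hτp' : 0 < p.2 - s₀ := lt_of_le_of_ne hτp (fun h => by
        simp only [hΨ] at hΨp; rw [← h] at hΨp; simp at hΨp)
      have hφp : 0 < φ p.1 := lt_of_le_of_ne (hφ0 _) (fun h => by
        simp only [hΨ] at hΨp; rw [← h] at hΨp; simp at hΨp)
      have hpin : p.1 ∈ ball x₀ (3 * R / 4) := by
        rw [mem_ball, dist_eq_norm]
        by_contra hcon
        push Not at hcon
        rw [hφzero _ hcon] at hφp
        exact lt_irrefl _ hφp
      have hNle : ∀ q ∈ Kc, Ψ q * G q - M * U q ≤ 0 := by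
        intro q hq
        have h1 : Ψ q * G q / U q ≤ M := hpmax hq
        rw [div_le_iff₀ (hUpos q (hKΩ hq)).1] at h1
        linarith
      have hN0 : Ψ p * G p - M * U p = 0 := by rw [hMU]; ring
      have hmp := max_point_ineq ee th U (fun q => f q.1) Ψ p (((n : ℝ) - 1) * K) (hUs p hpΩ)
        (hFs p) (hΨs p) (by
          filter_upwards [hΩo.mem_nhds hpΩ] with q hq
          exact hpdeΩ q hq) hUp.1 hΨp hGp (by
          have h1 := hH p.1 hpΩ.1 (∑ i, DD (ee i) U p • EuclideanSpace.single i (1 : ℝ))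
          rw [hess_expand hf, norm_sq_expand] at h1
          have h2 : ∀ i j, DD (ee i) (DD (ee j) (fun q : EuclideanSpace ℝ (Fin n) × ℝ => f q.1)) p
              = DD (EuclideanSpace.single i 1) (DD (EuclideanSpace.single j 1) f) p.1 := by
            intro i j
            have e : DD (ee j) (fun q : EuclideanSpace ℝ (Fin n) × ℝ => f q.1)
                = fun q => DD (EuclideanSpace.single j 1) f q.1 :=
              funext fun q => DD_fst q (hfd _) _
            have s1 : Sm f p.1 := hf.contDiffAt
            rw [e, DD_fst _ (s1.D _).diff]; rfl
          simp_rw [h2]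
          linarith) M hMU (by
          intro k
          have hev : ∀ᶠ s : ℝ in nhds 0, (p + s • ee k).1 ∈ ball x₀ (3 * R / 4) := by
            have h1 := line_tendsto p (ee k)
            have h2 := (continuous_fst.tendsto p).comp h1
            exact h2.eventually (isOpen_ball.mem_nhds hpin)
          change ∀ᶠ s : ℝ in nhds 0, _ ≤ _
          filter_upwards [hev] with s hs
          have hmem : p + s • ee k ∈ Kc := by
            refine ⟨ball_subset_closedBall hs, ?_⟩
            simpa [ee] using hpK.2
          have h3 := hNle _ hmem
          have h4 : p + (0 : ℝ) • ee k = p := by simp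
          simp only [h4]
          linarith) (by
          have hlt : s₀ - p.2 < 0 := by linarith
          filter_upwards [Ioo_mem_nhdsLT hlt] with s hs
          have hmem : p + s • th ∈ Kc := by
            have e1 : (p + s • th).1 = p.1 := by simp [th]
            have e2 : (p + s • th).2 = p.2 + s := by simp [th]
            refine ⟨by rw [e1]; exact hpK.1, ?_⟩
            rw [e2]
            exact ⟨by linarith [hs.1], by linarith [hs.2, hpK.2.2]⟩
          have h3 := hNle _ hmem
          exact h3.trans hN0.ge)
      simp_rw [hΨ1, hΨ2, hΨt] at hmp
      refine final_scalar (τ₁ := p.2 - s₀) (φ := φ p.1)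
        (S := ∑ i, DD (EuclideanSpace.single i 1) φ p.1 ^ 2)
        (Λ := ∑ i, DD (EuclideanSpace.single i 1) (DD (EuclideanSpace.single i 1) φ) p.1
          - ∑ i, DD (EuclideanSpace.single i 1) f p.1 * DD (EuclideanSpace.single i 1) φ p.1)
        (κ := ((n : ℝ) - 1) * K) (U := U p) hτp' (by linarith [hpK.2.2]) hφp (hφ1 _) hC hR0
        hUp.1 hUp.2 (mul_nonneg (by linarith) hK) (by nlinarith) hB0 (hφg _ hpΩ.1)
        (hφL _ hpΩ.1) ?_
      have e1 : ∑ k : Fin n, ((p.2 - s₀) * DD (EuclideanSpace.single k 1) φ p.1) ^ 2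
          = (p.2 - s₀) ^ 2 * ∑ k : Fin n, DD (EuclideanSpace.single k 1) φ p.1 ^ 2 := by
        rw [Finset.mul_sum]
        exact Finset.sum_congr rfl fun k _ => by ring
      have e2 : ∑ k : Fin n, DD (ee k) (fun q : EuclideanSpace ℝ (Fin n) × ℝ => f q.1) p
            * ((p.2 - s₀) * DD (EuclideanSpace.single k 1) φ p.1)
          = (p.2 - s₀) * ∑ k : Fin n, DD (EuclideanSpace.single k 1) f p.1
            * DD (EuclideanSpace.single k 1) φ p.1 := by
        rw [Finset.mul_sum]
        refine Finset.sum_congr rfl fun k _ => ?_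
        rw [DD_fst _ (hfd _)]
        simp only [ee]; ring
      rw [e1, e2, ← Finset.mul_sum] at hmp
      rw [mul_sub (p.2 - s₀)]
      exact hmp
  have hfin : Ψ (x, t) * G (x, t) / U (x, t) ≤ M := hpmax hxt
  have hΨxt : Ψ (x, t) = t - s₀ := by simp [hΨ, hφone x hx]
  have hUxt := hUpos _ (hKΩ hxt)
  rw [hgrad x t (hKΩ hxt)]
  change G (x, t) ≤ U (x, t) * _
  rw [hΨxt, div_le_iff₀ hUxt.1] at hfin
  have h1 : (t - s₀) * G (x, t) ≤ (t - s₀) * (U (x, t) * (D * (4 / (t - s₀)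
      + (10 * (C / R ^ 2) + 8 * (n * K) + 4 * (C * B))))) := by
    have h2 := mul_le_mul_of_nonneg_right hMbound hUxt.1.le
    refine (hfin.trans h2).trans (le_of_eq ?_)
    field_simp
  have h2 := le_of_mul_le_mul_left h1 hτ
  refine h2.trans ?_
  have hU0 := hUxt.1.le
  gcongr
  have e : t - s₀ = (t - t₀ + T) / 2 := by simp only [hs₀]; ring
  have hq : 0 < t - t₀ + T := by linarith [ht.1]
  have e' : 4 / (t - s₀) = 8 * (1 / (t - t₀ + T)) := by rw [e]; field_simp; norm_num
  rw [e', hB]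
  have b1 : 0 ≤ 1 / (t - t₀ + T) := by positivity
  have b2 : 0 ≤ 1 / R ^ 2 := by positivity
  have b3 : 0 ≤ |alphaC f x₀| / R := by positivity
  have b4 : C / R ^ 2 = C * (1 / R ^ 2) := by ring
  rw [b4]
  generalize 1 / (t - t₀ + T) = w1 at *
  generalize 1 / R ^ 2 = w2 at *
  generalize |alphaC f x₀| / R = w3 at *
  have c1 := mul_nonneg hC.le b1
  have c2 := mul_nonneg hC.le b2
  have c3 := mul_nonneg hC.le b3
  have c4 := mul_nonneg hC.le hK
  have hn' : (0 : ℝ) ≤ n := by linarith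
  have d1 := mul_nonneg hn' b1
  have d2 := mul_nonneg hn' b2
  have d3 := mul_nonneg hn' b3
  have d4 := mul_nonneg hn' hK
  nlinarith

/-- Elliptic gradient estimate for the `f`-heat equation (Euclidean case of estimate (3.11),
the `a = 0` case of Theorem 1.1). -/
theorem fheat_gradient_estimate (n : ℕ) (hn : 1 ≤ n) :
    ∃ c : ℝ, 0 < c ∧
      ∀ (f : EuclideanSpace ℝ (Fin n) → ℝ) (x₀ : EuclideanSpace ℝ (Fin n))
        (R K t₀ T D : ℝ) (u : EuclideanSpace ℝ (Fin n) → ℝ → ℝ),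
        ContDiff ℝ (⊤ : ℕ∞) f →
        2 ≤ R → 0 ≤ K → 0 < T → 0 < D →
        (∀ x ∈ ball x₀ R, ∀ v : EuclideanSpace ℝ (Fin n),
          hessQF f x v ≥ -((n : ℝ) - 1) * K * ‖v‖ ^ 2) →
        ContDiffOn ℝ (⊤ : ℕ∞) (fun p : EuclideanSpace ℝ (Fin n) × ℝ => u p.1 p.2)
          (ball x₀ R ×ˢ Icc (t₀ - T) t₀) →
        (∀ x ∈ ball x₀ R, ∀ t ∈ Icc (t₀ - T) t₀, 0 < u x t ∧ u x t ≤ D) →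
        (∀ x ∈ ball x₀ R, ∀ t ∈ Icc (t₀ - T) t₀,
          deriv (fun s => u x s) t = fLap f (fun y => u y t) x) →
        ∀ x ∈ ball x₀ (R / 2), ∀ t ∈ Ioc (t₀ - T) t₀,
          ‖gradient (fun y => u y t) x‖ / Real.sqrt (u x t) ≤
            c * Real.sqrt D *
              (1 / R + Real.sqrt (|alphaC f x₀| / R) + 1 / Real.sqrt (t - t₀ + T)
                + Real.sqrt K) := by
  obtain ⟨c, hc, hinter⟩ := interior_estimate n hn
  refine ⟨Real.sqrt c, Real.sqrt_pos.2 hc, ?_⟩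
  intro f x₀ R K t₀ T D u hf hR hK hT hD hH hu hpos hpde x hx
  have hR0 : 0 < R := by linarith
  have hxR : x ∈ ball x₀ R := ball_subset_ball (by linarith) hx
  -- the estimate for interior times
  have hI : ∀ t ∈ Ioo (t₀ - T) t₀,
      ‖gradient (fun y => u y t) x‖ / Real.sqrt (u x t) ≤ Real.sqrt c * Real.sqrt D *
              (1 / R + Real.sqrt (|alphaC f x₀| / R) + 1 / Real.sqrt (t - t₀ + T)
                + Real.sqrt K) := by
    intro t ht
    have h := hinter f x₀ R K t₀ T D u hf hR hK hT hD hH hu hpos hpde x hx t ht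
    have hu0 : 0 < u x t := (hpos x hxR t (Ioo_subset_Icc_self ht)).1
    have hq : 0 < t - t₀ + T := by linarith [ht.1]
    rw [div_le_iff₀ (Real.sqrt_pos.2 hu0)]
    refine le_of_sq_le_sq ?_ (by positivity)
    refine h.trans ?_
    have hα : 0 ≤ |alphaC f x₀| / R := by positivity
    rw [mul_pow, mul_pow, mul_pow, Real.sq_sqrt hc.le, Real.sq_sqrt hD.le, Real.sq_sqrt hu0.le]
    have key : 1 / R ^ 2 + |alphaC f x₀| / R + 1 / (t - t₀ + T) + K ≤
        (1 / R + Real.sqrt (|alphaC f x₀| / R) + 1 / Real.sqrt (t - t₀ + T)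
                + Real.sqrt K) ^ 2 := by
      have e1 : 1 / R ^ 2 = (1 / R) ^ 2 := by ring
      have e2 : |alphaC f x₀| / R = Real.sqrt (|alphaC f x₀| / R) ^ 2 := (Real.sq_sqrt hα).symm
      have e3 : 1 / (t - t₀ + T) = (1 / Real.sqrt (t - t₀ + T)) ^ 2 := by
        rw [div_pow, Real.sq_sqrt hq.le]; norm_num
      have e4 : K = Real.sqrt K ^ 2 := (Real.sq_sqrt hK).symm
      have n1 : 0 ≤ 1 / R := by positivity
      have n2 := Real.sqrt_nonneg (|alphaC f x₀| / R)
      have n3 : 0 ≤ 1 / Real.sqrt (t - t₀ + T) := by positivity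
      have n4 := Real.sqrt_nonneg K
      generalize 1 / R = a at *
      generalize Real.sqrt (|alphaC f x₀| / R) = b at *
      generalize 1 / Real.sqrt (t - t₀ + T) = d at *
      generalize Real.sqrt K = m at *
      rw [e1, e2, e3, e4]
      have : 0 ≤ a * b + a * d + a * m + b * d + b * m + d * m := by positivity
      nlinarith
    calc u x t * (D * (c * (1 / R ^ 2 + |alphaC f x₀| / R + 1 / (t - t₀ + T) + K)))
        ≤ u x t * (D * (c * (1 / R + Real.sqrt (|alphaC f x₀| / R)
          + 1 / Real.sqrt (t - t₀ + T) + Real.sqrt K) ^ 2)) := by gcongr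
      _ = _ := by ring
  intro t ht
  rcases lt_or_eq_of_le ht.2 with hlt | heq
  · exact hI t ⟨ht.1, hlt⟩
  -- the final time, by continuity
  subst heq
  set U : EuclideanSpace ℝ (Fin n) × ℝ → ℝ := fun p => u p.1 p.2 with hU
  set S : Set (EuclideanSpace ℝ (Fin n) × ℝ) := ball x₀ R ×ˢ Icc (t - T) t with hS
  have hSu : UniqueDiffOn ℝ S :=
    isOpen_ball.uniqueDiffOn.prod (uniqueDiffOn_Icc (by linarith))
  have hnorm : ∀ s ∈ Icc (t - T) t, ‖gradient (fun y => u y s) x‖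
      = ‖(fderivWithin ℝ U S (x, s)).comp (ContinuousLinearMap.inl ℝ _ ℝ)‖ := by
    intro s hs
    have hd : DifferentiableWithinAt ℝ U S (x, s) :=
      hu.differentiableOn (by simp) (x, s) ⟨hxR, hs⟩
    have h1 : HasFDerivAt (fun y : EuclideanSpace ℝ (Fin n) => (y, s))
      (ContinuousLinearMap.inl ℝ _ _) x := hasFDerivAt_prodMk_left x s
    have hmaps : MapsTo (fun y : EuclideanSpace ℝ (Fin n) => (y, s)) (ball x₀ R) S :=
      fun y hy => ⟨hy, hs⟩
    have h2 := (hd.hasFDerivWithinAt.comp x (h1.hasFDerivWithinAt (s := ball x₀ R))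
      hmaps).hasFDerivAt (isOpen_ball.mem_nhds hxR)
    have h3 : fderiv ℝ (fun y => u y s) x = _ := h2.fderiv
    unfold gradient
    rw [LinearIsometryEquiv.norm_map, h3]
  have hline : ContinuousWithinAt (fun s : ℝ => (x, s)) (Icc (t - T) t) t := by fun_prop
  have htm : t ∈ Icc (t - T) t := ⟨by linarith, le_rfl⟩
  have hc1 : ContinuousWithinAt (fun s => fderivWithin ℝ U S (x, s)) (Icc (t - T) t) t :=
    ContinuousWithinAt.comp (t := S)
      ((hu.continuousOn_fderivWithin hSu (by simp)) (x, t) ⟨hxR, htm⟩) hline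
      (fun s hs => ⟨hxR, hs⟩)
  have hc2 : ContinuousWithinAt (fun s => u x s) (Icc (t - T) t) t :=
    ContinuousWithinAt.comp (t := S) (g := U)
      (hu.continuousOn (x, t) ⟨hxR, htm⟩) hline (fun s hs => ⟨hxR, hs⟩)
  have hc3 : ContinuousWithinAt (fun s => ‖gradient (fun y => u y s) x‖) (Icc (t - T) t) t := by
    have h1 : ContinuousWithinAt (fun s => ‖(fderivWithin ℝ U S (x, s)).comp
        (ContinuousLinearMap.inl ℝ (EuclideanSpace ℝ (Fin n)) ℝ)‖) (Icc (t - T) t) t :=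
      (hc1.clm_comp continuousWithinAt_const).norm
    exact h1.congr hnorm (hnorm t htm)
  have hu0 : 0 < u x t := (hpos x hxR t htm).1
  have hl : ContinuousWithinAt (fun s => ‖gradient (fun y => u y s) x‖ / Real.sqrt (u x s))
      (Ioo (t - T) t) t :=
    (hc3.div (Real.continuous_sqrt.continuousAt.comp_continuousWithinAt hc2)
      (Real.sqrt_pos.2 hu0).ne').mono Ioo_subset_Icc_self
  have hr : ContinuousWithinAt (fun s => Real.sqrt c * Real.sqrt D *
              (1 / R + Real.sqrt (|alphaC f x₀| / R) + 1 / Real.sqrt (s - t + T)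
                + Real.sqrt K)) (Ioo (t - T) t) t := by
    have h0 : Real.sqrt (t - t + T) ≠ 0 := (Real.sqrt_pos.2 (by linarith)).ne'
    have h1 : ContinuousAt (fun s : ℝ => 1 / Real.sqrt (s - t + T)) t :=
      continuousAt_const.div (by fun_prop) h0
    exact (continuousAt_const.mul ((continuousAt_const.add h1).add
      continuousAt_const)).continuousWithinAt
  have hne : (nhdsWithin t (Ioo (t - T) t)).NeBot := by
    rw [← mem_closure_iff_nhdsWithin_neBot, closure_Ioo (by linarith)]
    exact htm
  refine le_of_tendsto_of_tendsto hl hr ?_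
  filter_upwards [self_mem_nhdsWithin] with s hs
  exact hI s hs
end
end

section
/- Let n ≥ 1 and let f : ℝⁿ → ℝ be smooth with ⟨Hess f(x) v, v⟩ ≥ −(n−1)K|v|² for all x ∈ ℝⁿ and v ∈ ℝⁿ, where K ≥ 0. If u : ℝⁿ × (−∞, 0] → ℝ is a smooth positive ancient solution to the f-heat equation ∂u/∂t = Δ_f u with 0 < u(x,t) ≤ D for some constant D and all (x,t), then |∇u|(x,t) ≤ c·D·√K for all (x,t), where c is a constant depending only on n. (This is the Euclidean-space case of the paper's Corollary 3.1.) -/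
open Metric Set
open scoped RealInnerProductSpace

noncomputable section

open Filter Topology

/-- directional derivative -/
def dd {X : Type*} [NormedAddCommGroup X] [NormedSpace ℝ X] (w : X) (g : X → ℝ) (p : X) : ℝ :=
  fderiv ℝ g p w

section ddlem
variable {X : Type*} [NormedAddCommGroup X] [NormedSpace ℝ X]

lemma dd_smooth {O : Set X} (hO : IsOpen O) {g : X → ℝ} (hg : ContDiffOn ℝ (⊤ : ℕ∞) g O) (w : X) :
    ContDiffOn ℝ (⊤ : ℕ∞) (dd w g) O := by
  have h := hg.fderiv_of_isOpen (m := (⊤ : ℕ∞)) hO (by simp)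
  exact h.clm_apply contDiffOn_const

lemma smooth_diffAt {O : Set X} (hO : IsOpen O) {g : X → ℝ} (hg : ContDiffOn ℝ (⊤ : ℕ∞) g O)
    {p : X} (hp : p ∈ O) : DifferentiableAt ℝ g p :=
  (hg.contDiffAt (hO.mem_nhds hp)).differentiableAt (by simp)

lemma dd_comm {O : Set X} (hO : IsOpen O) {g : X → ℝ} (hg : ContDiffOn ℝ (⊤ : ℕ∞) g O)
    (w z : X) {p : X} (hp : p ∈ O) : dd w (dd z g) p = dd z (dd w g) p := by
  have hc : ContDiffAt ℝ (⊤ : ℕ∞) g p := hg.contDiffAt (hO.mem_nhds hp)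
  have hs : IsSymmSndFDerivAt ℝ g p := hc.isSymmSndFDerivAt (by simp only [minSmoothness_of_isRCLikeNormedField]; exact WithTop.coe_le_coe.2 le_top)
  have hd : DifferentiableAt ℝ (fderiv ℝ g) p :=
    ((hg.fderiv_of_isOpen (m := (⊤ : ℕ∞)) hO (by simp)).contDiffAt
      (hO.mem_nhds hp)).differentiableAt (by simp)
  have key : ∀ a b : X, dd a (dd b g) p = fderiv ℝ (fderiv ℝ g) p a b := by
    intro a b
    have := (hd.hasFDerivAt.clm_apply (hasFDerivAt_const b p)).fderiv
    change fderiv ℝ (fun y => fderiv ℝ g y b) p a = _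
    rw [this]; simp
  rw [key, key, hs.eq]

lemma dd_congr {O : Set X} (hO : IsOpen O) {g h : X → ℝ} (hgh : ∀ p ∈ O, g p = h p)
    (w : X) {p : X} (hp : p ∈ O) : dd w g p = dd w h p := by
  have : g =ᶠ[𝓝 p] h := by filter_upwards [hO.mem_nhds hp] with q hq using hgh q hq
  simp [dd, this.fderiv_eq]

lemma line_deriv {O : Set X} (hO : IsOpen O) {g : X → ℝ} (hg : ContDiffOn ℝ (⊤ : ℕ∞) g O)
    (w p : X) {h : ℝ} (hp : p + h • w ∈ O) :
    HasDerivAt (fun h : ℝ => g (p + h • w)) (dd w g (p + h • w)) h := by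
  have h1 : HasDerivAt (fun h : ℝ => p + h • w) w h := by
    simpa using ((hasDerivAt_id h).smul_const w).const_add p
  exact (smooth_diffAt hO hg hp).hasFDerivAt.comp_hasDerivAt h h1

end ddlem

lemma snd_deriv_nonpos {g g' : ℝ → ℝ} {a : ℝ} (h1 : ∀ᶠ h in 𝓝 0, HasDerivAt g (g' h) h)
    (h2 : HasDerivAt g' a 0) (hm : IsLocalMax g 0) : g' 0 = 0 ∧ a ≤ 0 := by
  have h0 : g' 0 = 0 := hm.hasDerivAt_eq_zero h1.self_of_nhds
  refine ⟨h0, ?_⟩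
  by_contra! ha
  have e1 : deriv g =ᶠ[𝓝 0] g' := by filter_upwards [h1] with h hh using hh.deriv
  have hd : deriv (deriv g) 0 = a := by rw [e1.deriv_eq]; exact h2.deriv
  have hmin : IsLocalMin g 0 := isLocalMin_of_deriv_deriv_pos (by rw [hd]; exact ha)
    (by rw [e1.eq_of_nhds, h0]) h1.self_of_nhds.continuousAt
  have hc : g =ᶠ[𝓝 0] fun _ => g 0 := by
    filter_upwards [hm, hmin] with h p q using le_antisymm p q
  have : deriv (deriv g) 0 = 0 := by
    have : deriv g =ᶠ[𝓝 0] fun _ => 0 := by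
      have := hc.deriv
      simpa using this
    rw [this.deriv_eq]; simp
  linarith

lemma left_deriv_nonneg {g : ℝ → ℝ} {a : ℝ} (h : HasDerivAt g a 0)
    (hm : ∀ᶠ x in 𝓝[<] (0:ℝ), g x ≤ g 0) : 0 ≤ a := by
  have ht := (hasDerivAt_iff_tendsto_slope_left_right.1 h).1
  refine ge_of_tendsto ht ?_
  filter_upwards [hm, self_mem_nhdsWithin] with x hx hx0
  rw [slope_def_field]
  have : x < 0 := hx0
  exact div_nonneg_of_nonpos (by linarith) (by linarith)

lemma line_max {φ φ' v v' u u' : ℝ → ℝ} {φ'' v'' u'' s A : ℝ}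
    (hφ : ∀ᶠ h in 𝓝 0, HasDerivAt φ (φ' h) h) (hφ' : HasDerivAt φ' φ'' 0)
    (hv : ∀ᶠ h in 𝓝 0, HasDerivAt v (v' h) h) (hv' : HasDerivAt v' v'' 0)
    (hu : ∀ᶠ h in 𝓝 0, HasDerivAt u (u' h) h) (hu' : HasDerivAt u' u'' 0)
    (hm : IsLocalMax (fun h => s * φ h ^ 2 * v h ^ 2 + A * u h ^ 2) 0) :
    s * (2 * φ 0 * φ' 0 * v 0 ^ 2 + 2 * φ 0 ^ 2 * v 0 * v' 0) + 2 * A * u 0 * u' 0 = 0 ∧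
    s * (2 * φ' 0 ^ 2 * v 0 ^ 2 + 2 * φ 0 * φ'' * v 0 ^ 2 + 8 * φ 0 * φ' 0 * v 0 * v' 0
      + 2 * φ 0 ^ 2 * v' 0 ^ 2 + 2 * φ 0 ^ 2 * v 0 * v'') + 2 * A * (u' 0 ^ 2 + u 0 * u'') ≤ 0 := by
  have h1 : ∀ᶠ h in 𝓝 0, HasDerivAt (fun h => s * φ h ^ 2 * v h ^ 2 + A * u h ^ 2)
      (s * (2 * φ h * φ' h * v h ^ 2 + 2 * φ h ^ 2 * v h * v' h) + 2 * A * u h * u' h) h := by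
    filter_upwards [hφ, hv, hu] with h a b c
    exact ((((a.pow 2).const_mul s).mul (b.pow 2)).add ((c.pow 2).const_mul A)).congr_deriv
      (by simp; ring)
  have a := hφ.self_of_nhds
  have b := hv.self_of_nhds
  have c := hu.self_of_nhds
  have h2 : HasDerivAt (fun h => s * (2 * φ h * φ' h * v h ^ 2 + 2 * φ h ^ 2 * v h * v' h)
      + 2 * A * u h * u' h) (s * (2 * φ' 0 ^ 2 * v 0 ^ 2 + 2 * φ 0 * φ'' * v 0 ^ 2
      + 8 * φ 0 * φ' 0 * v 0 * v' 0
      + 2 * φ 0 ^ 2 * v' 0 ^ 2 + 2 * φ 0 ^ 2 * v 0 * v'') + 2 * A * (u' 0 ^ 2 + u 0 * u'')) 0 := by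
    exact (((((((a.const_mul 2).mul hφ').mul (b.pow 2))).add
      ((((a.pow 2).const_mul 2).mul b).mul hv')).const_mul s).add
      ((c.const_mul (2*A)).mul hu')).congr_deriv (by simp; ring)
  exact snd_deriv_nonpos h1 h2 hm

/-- The final algebra at an interior maximum point. -/
lemma final_alg {n : ℕ} (s φ v u A κ T R vt ut : ℝ) (φi vi ui fi vii uii : Fin n → ℝ)
    (φii M : ℝ) (hs0 : 0 < s) (hs1 : s ≤ 1) (hφ0 : 0 < φ) (hφ1 : φ ≤ 1) (hv : 0 < v)
    (hT : 0 < T) (hκ : 0 ≤ κ)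
    (e1 : ∀ i, s * (2 * φ * φi i * v ^ 2 + 2 * φ ^ 2 * v * vi i) + 2 * A * u * ui i = 0)
    (e2 : ∀ i, s * (2 * φi i ^ 2 * v ^ 2 + 2 * φ * φii * v ^ 2 + 8 * φ * φi i * v * vi i
      + 2 * φ ^ 2 * vi i ^ 2 + 2 * φ ^ 2 * v * vii i) + 2 * A * (ui i ^ 2 + u * uii i) ≤ 0)
    (e3 : 0 ≤ φ ^ 2 * v ^ 2 / T + 2 * s * φ ^ 2 * v * vt + 2 * A * u * ut)
    (hut : ut = ∑ i, uii i - ∑ i, fi i * ui i)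
    (hvt : vt ≤ ∑ i, vii i - ∑ i, fi i * vi i + κ * v)
    (hui : ∑ i, ui i ^ 2 = v ^ 2)
    (hφi : ∑ i, φi i ^ 2 ≤ 4 / R ^ 2)
    (hM : ∑ i, (φii - fi i * φi i) ≥ -M) (hM0 : 0 ≤ M) :
    2 * A ≤ 1 / T + 2 * κ + 24 / R ^ 2 + 2 * M := by
  have hsum := Finset.sum_nonpos (s := Finset.univ) (fun i _ => e2 i)
  have hsum1 : ∑ i, fi i * (s * (2 * φ * φi i * v ^ 2 + 2 * φ ^ 2 * v * vi i)
      + 2 * A * u * ui i) = 0 := Finset.sum_eq_zero (fun i _ => by rw [e1 i, mul_zero])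
  -- completing the square
  have hsq : 0 ≤ ∑ i, s * (2 * (φ * vi i + 2 * φi i * v) ^ 2) :=
    Finset.sum_nonneg (fun i _ => by positivity)
  have hid : ∑ i, (s * (2 * φi i ^ 2 * v ^ 2 + 2 * φ * φii * v ^ 2 + 8 * φ * φi i * v * vi i
      + 2 * φ ^ 2 * vi i ^ 2 + 2 * φ ^ 2 * v * vii i) + 2 * A * (ui i ^ 2 + u * uii i))
      - ∑ i, fi i * (s * (2 * φ * φi i * v ^ 2 + 2 * φ ^ 2 * v * vi i) + 2 * A * u * ui i)
      = ∑ i, s * (2 * (φ * vi i + 2 * φi i * v) ^ 2) - 6 * s * v ^ 2 * ∑ i, φi i ^ 2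
        + 2 * s * φ * v ^ 2 * ∑ i, (φii - fi i * φi i)
        + 2 * s * φ ^ 2 * v * (∑ i, vii i - ∑ i, fi i * vi i)
        + 2 * A * ∑ i, ui i ^ 2 + 2 * A * u * (∑ i, uii i - ∑ i, fi i * ui i) := by
    simp only [Finset.mul_sum, ← Finset.sum_sub_distrib, ← Finset.sum_add_distrib]
    exact Finset.sum_congr rfl (fun i _ => by ring)
  rw [hsum1, ← hut, hui] at hid
  have hv2 : 0 < v ^ 2 := by positivity
  have b1 : 6 * s * v ^ 2 * ∑ i, φi i ^ 2 ≤ v ^ 2 * (24 / R ^ 2) := by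
    have h0 : 0 ≤ ∑ i, φi i ^ 2 := Finset.sum_nonneg (fun i _ => sq_nonneg _)
    calc 6 * s * v ^ 2 * ∑ i, φi i ^ 2 ≤ 6 * 1 * v ^ 2 * (4 / R ^ 2) := by gcongr
      _ = _ := by ring
  have b2 : -(v ^ 2 * (2 * M)) ≤ 2 * s * φ * v ^ 2 * ∑ i, (φii - fi i * φi i) := by
    have : 2 * s * φ * v ^ 2 * (-M) ≤ 2 * s * φ * v ^ 2 * ∑ i, (φii - fi i * φi i) :=
      mul_le_mul_of_nonneg_left hM (by positivity)
    have h2 : 2 * s * φ * v ^ 2 * M ≤ 2 * 1 * 1 * v ^ 2 * M := by gcongr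
    linarith
  have b3 : 2 * s * φ ^ 2 * v * vt ≤ 2 * s * φ ^ 2 * v * (∑ i, vii i - ∑ i, fi i * vi i)
      + v ^ 2 * (2 * κ) := by
    have : 2 * s * φ ^ 2 * v * vt ≤ 2 * s * φ ^ 2 * v *
      (∑ i, vii i - ∑ i, fi i * vi i + κ * v) := mul_le_mul_of_nonneg_left hvt (by positivity)
    have h2 : 2 * s * φ ^ 2 * v * (κ * v) ≤ 2 * 1 * 1 ^ 2 * v * (κ * v) := by gcongr
    linarith
  have b4 : φ ^ 2 * v ^ 2 / T ≤ v ^ 2 * (1 / T) := by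
    have : φ ^ 2 * v ^ 2 / T ≤ 1 ^ 2 * v ^ 2 / T := by gcongr
    rw [one_pow, one_mul] at this
    rw [mul_one_div]; exact this
  have : v ^ 2 * (2 * A) ≤ v ^ 2 * (1 / T + 2 * κ + 24 / R ^ 2 + 2 * M) := by
    linarith
  exact le_of_mul_le_mul_left this hv2

section core
variable {n : ℕ}

lemma dd_lin (g : EuclideanSpace ℝ (Fin n) → ℝ) (w x : EuclideanSpace ℝ (Fin n)) :
    dd w g x = ∑ i, w i * dd (EuclideanSpace.single i 1) g x := by
  have : w = ∑ i, w i • EuclideanSpace.single i (1:ℝ) := by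
    have := (EuclideanSpace.basisFun (Fin n) ℝ).sum_repr w
    simpa using this.symm
  unfold dd
  conv_lhs => rw [this]
  simp

lemma dd_lin2 (g : EuclideanSpace ℝ (Fin n) × ℝ → ℝ) (w : EuclideanSpace ℝ (Fin n))
    (p : EuclideanSpace ℝ (Fin n) × ℝ) :
    dd (w, (0:ℝ)) g p = ∑ i, w i * dd (EuclideanSpace.single i 1, (0:ℝ)) g p := by
  have : (w, (0:ℝ)) = ∑ i, w i • ((EuclideanSpace.single i (1:ℝ) : EuclideanSpace ℝ (Fin n)), (0:ℝ)) := by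
    have := (EuclideanSpace.basisFun (Fin n) ℝ).sum_repr w
    ext1
    · simpa [Prod.fst_sum] using this.symm
    · simp [Prod.snd_sum]
  unfold dd
  conv_lhs => rw [this]
  rw [map_sum]
  exact Finset.sum_congr rfl (fun i _ => by rw [map_smul, smul_eq_mul])

lemma dd_add' {X : Type*} [NormedAddCommGroup X] [NormedSpace ℝ X] {w p : X} {ι : Type*}
    (s : Finset ι) {g : ι → X → ℝ} (hg : ∀ i ∈ s, DifferentiableAt ℝ (g i) p) :
    dd w (fun q => ∑ i ∈ s, g i q) p = ∑ i ∈ s, dd w (g i) p := by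
  simp [dd, fderiv_fun_sum hg]

lemma dd_mul' {X : Type*} [NormedAddCommGroup X] [NormedSpace ℝ X] {w p : X}
    {g h : X → ℝ} (hg : DifferentiableAt ℝ g p) (hh : DifferentiableAt ℝ h p) :
    dd w (fun q => g q * h q) p = g p * dd w h p + dd w g p * h p := by
  simp [dd, fderiv_fun_mul hg hh]; ring

lemma dd_sub' {X : Type*} [NormedAddCommGroup X] [NormedSpace ℝ X] {w p : X}
    {g h : X → ℝ} (hg : DifferentiableAt ℝ g p) (hh : DifferentiableAt ℝ h p) :
    dd w (fun q => g q - h q) p = dd w g p - dd w h p := by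
  simp [dd, fderiv_fun_sub hg hh]

/-- Convexity type inequality from the Hessian bound. -/
lemma drift_bound {f : EuclideanSpace ℝ (Fin n) → ℝ} {κ : ℝ} (hf : ContDiff ℝ (⊤ : ℕ∞) f)
    (hess : ∀ x v, hessQF f x v ≥ -κ * ‖v‖ ^ 2) (x₀ y : EuclideanSpace ℝ (Fin n)) :
    dd y f (x₀ + y) ≥ - ‖fderiv ℝ f x₀‖ * ‖y‖ - κ * ‖y‖ ^ 2 := by
  have hf' : ContDiffOn ℝ (⊤ : ℕ∞) f univ := hf.contDiffOn
  have hd := dd_smooth isOpen_univ hf' y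
  have h1 : ∀ h : ℝ, HasDerivAt (fun h : ℝ => dd y f (x₀ + h • y) + κ * ‖y‖ ^ 2 * h)
      (dd y (dd y f) (x₀ + h • y) + κ * ‖y‖ ^ 2) h := by
    intro h
    have a := line_deriv isOpen_univ hd y x₀ (h := h) (mem_univ _)
    exact (a.add ((hasDerivAt_id h).const_mul (κ * ‖y‖ ^ 2))).congr_deriv (by simp)
  have hm : Monotone (fun h : ℝ => dd y f (x₀ + h • y) + κ * ‖y‖ ^ 2 * h) := by
    refine monotone_of_deriv_nonneg (fun h => (h1 h).differentiableAt) (fun h => ?_)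
    rw [(h1 h).deriv]
    have := hess (x₀ + h • y) y
    change dd y (dd y f) _ ≥ _ at this
    linarith
  have := hm (zero_le_one)
  simp only [zero_smul, add_zero, mul_zero, one_smul, mul_one] at this
  have h2 : |dd y f x₀| ≤ ‖fderiv ℝ f x₀‖ * ‖y‖ := (fderiv ℝ f x₀).le_opNorm y
  have := neg_abs_le (dd y f x₀)
  linarith

lemma V_eq {f : EuclideanSpace ℝ (Fin n) → ℝ} {U : EuclideanSpace ℝ (Fin n) × ℝ → ℝ}
    (hf : ContDiff ℝ (⊤ : ℕ∞) f) {O : Set (EuclideanSpace ℝ (Fin n) × ℝ)} (hO : IsOpen O)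
    (hU : ContDiffOn ℝ (⊤ : ℕ∞) U O)
    (heq : ∀ p ∈ O, dd (0, (1:ℝ)) U p =
      ∑ i, dd (EuclideanSpace.single i 1, (0:ℝ)) (dd (EuclideanSpace.single i 1, (0:ℝ)) U) p
      - ∑ i, dd (EuclideanSpace.single i 1) f p.1 * dd (EuclideanSpace.single i 1, (0:ℝ)) U p)
    (e : EuclideanSpace ℝ (Fin n)) {p} (hp : p ∈ O) :
    dd (0, (1:ℝ)) (dd (e, (0:ℝ)) U) p =
      ∑ i, dd (EuclideanSpace.single i 1, (0:ℝ)) (dd (EuclideanSpace.single i 1, (0:ℝ))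
        (dd (e, (0:ℝ)) U)) p
      - ∑ i, dd (EuclideanSpace.single i 1) f p.1
          * dd (EuclideanSpace.single i 1, (0:ℝ)) (dd (e, (0:ℝ)) U) p
      - ∑ i, dd e (dd (EuclideanSpace.single i 1) f) p.1
          * dd (EuclideanSpace.single i 1, (0:ℝ)) U p := by
  have hfi : ∀ i : Fin n, ContDiff ℝ (⊤ : ℕ∞) (dd (EuclideanSpace.single i 1) f) := fun i =>
    contDiffOn_univ.1 (dd_smooth isOpen_univ hf.contDiffOn _)
  have hfd : ∀ i : Fin n, Differentiable ℝ (dd (EuclideanSpace.single i 1) f) := fun i =>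
    (hfi i).differentiable (by simp)
  have hfd' : ∀ i : Fin n, DifferentiableAt ℝ (fun q : EuclideanSpace ℝ (Fin n) × ℝ =>
      dd (EuclideanSpace.single i 1) f q.1) p := fun i =>
    (hfd i p.1).comp p differentiableAt_fst
  have hUi := fun i : Fin n => dd_smooth hO hU (EuclideanSpace.single i (1:ℝ), (0:ℝ))
  have hUii := fun i : Fin n => dd_smooth hO (hUi i) (EuclideanSpace.single i (1:ℝ), (0:ℝ))
  rw [dd_comm hO hU _ _ hp, dd_congr hO heq _ hp, dd_sub', dd_add', dd_add', sub_sub,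
    ← Finset.sum_add_distrib]
  · congr 1
    · refine Finset.sum_congr rfl (fun i _ => ?_)
      rw [dd_comm hO (hUi i) _ _ hp]
      exact dd_congr hO (fun q hq => dd_comm hO hU _ _ hq) _ hp
    · refine Finset.sum_congr rfl (fun i _ => ?_)
      rw [dd_mul' (hfd' i) (smooth_diffAt hO (hUi i) hp), dd_comm hO hU _ _ hp]
      congr 2
      have := ((hfd i p.1).hasFDerivAt.comp p (hasFDerivAt_fst (𝕜 := ℝ) (p := p))).fderiv
      unfold dd at this ⊢
      change fderiv ℝ ((fun p => fderiv ℝ f p _) ∘ Prod.fst) p _ = _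
      rw [this]; simp
  · intro i _
    exact (hfd' i).mul (smooth_diffAt hO (hUi i) hp)
  · intro i _
    exact smooth_diffAt hO (hUii i) hp
  · exact DifferentiableAt.fun_sum fun i _ => smooth_diffAt hO (hUii i) hp
  · exact DifferentiableAt.fun_sum fun i _ => (hfd' i).mul (smooth_diffAt hO (hUi i) hp)

lemma hess_sum {f : EuclideanSpace ℝ (Fin n) → ℝ} (hf : ContDiff ℝ (⊤ : ℕ∞) f)
    (e x : EuclideanSpace ℝ (Fin n)) :
    ∑ i, dd e (dd (EuclideanSpace.single i 1) f) x * e i = hessQF f x e := by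
  change _ = dd e (dd e f) x
  have hfd : ∀ i : Fin n, Differentiable ℝ (dd (EuclideanSpace.single i 1) f) := fun i =>
    (contDiffOn_univ.1 (dd_smooth isOpen_univ hf.contDiffOn _)).differentiable (by simp)
  have : dd e f = fun x => ∑ i, e i * dd (EuclideanSpace.single i 1) f x := by
    funext x; exact dd_lin f e x
  rw [this, dd_add']
  · refine Finset.sum_congr rfl (fun i _ => ?_)
    rw [dd_mul' (by fun_prop) (hfd i x)]
    simp [dd, mul_comm]
  · intro i _
    exact (differentiableAt_const _).mul (hfd i x)

end core

/-- At an interior maximum point the parameter `A` cannot be large. -/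
lemma max_point {n : ℕ} {f : EuclideanSpace ℝ (Fin n) → ℝ} {κ A R T t₁ t₀ : ℝ}
    {U : EuclideanSpace ℝ (Fin n) × ℝ → ℝ} {x₀ : EuclideanSpace ℝ (Fin n)}
    (hf : ContDiff ℝ (⊤ : ℕ∞) f) (hκ : 0 ≤ κ)
    (hess : ∀ x v, hessQF f x v ≥ -κ * ‖v‖ ^ 2)
    {O : Set (EuclideanSpace ℝ (Fin n) × ℝ)} (hO : IsOpen O)
    (hU : ContDiffOn ℝ (⊤ : ℕ∞) U O)
    (heq : ∀ p ∈ O, dd (0, (1:ℝ)) U p =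
      ∑ i, dd (EuclideanSpace.single i 1, (0:ℝ)) (dd (EuclideanSpace.single i 1, (0:ℝ)) U) p
      - ∑ i, dd (EuclideanSpace.single i 1) f p.1 * dd (EuclideanSpace.single i 1, (0:ℝ)) U p)
    (hR : 0 < R) (hT : 0 < T)
    (y : EuclideanSpace ℝ (Fin n)) (t : ℝ) (hp : (x₀ + y, t) ∈ O) (hy : ‖y‖ < R)
    (ht1 : t₁ < t) (ht0 : t ≤ t₀) (htT : t - t₁ ≤ T)
    (hW : 0 < ∑ i, dd (EuclideanSpace.single i 1, (0:ℝ)) U (x₀ + y, t) ^ 2)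
    (hmax : ∀ z : EuclideanSpace ℝ (Fin n), ‖z‖ < R → ∀ r : ℝ, t₁ < r → r ≤ t₀ →
      ((r - t₁) / T) * (1 - ‖z‖ ^ 2 / R ^ 2) ^ 2 *
        (∑ i, dd (EuclideanSpace.single i 1, (0:ℝ)) U (x₀ + z, r) ^ 2) + A * U (x₀ + z, r) ^ 2 ≤
      ((t - t₁) / T) * (1 - ‖y‖ ^ 2 / R ^ 2) ^ 2 *
        (∑ i, dd (EuclideanSpace.single i 1, (0:ℝ)) U (x₀ + y, t) ^ 2) + A * U (x₀ + y, t) ^ 2) :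
    2 * A ≤ 1 / T + 2 * κ + 24 / R ^ 2 +
      2 * ((2 * n + 2 * ‖fderiv ℝ f x₀‖ * R + 2 * κ * R ^ 2) / R ^ 2) := by
  set W : EuclideanSpace ℝ (Fin n) × ℝ → ℝ :=
    fun p => ∑ i, dd (EuclideanSpace.single i 1, (0:ℝ)) U p ^ 2 with hWdef
  set p : EuclideanSpace ℝ (Fin n) × ℝ := (x₀ + y, t) with hpdef
  set v₀ : ℝ := Real.sqrt (W p) with hv₀
  have hWp : 0 < W p := hW
  have hv₀pos : 0 < v₀ := Real.sqrt_pos.2 hWp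
  have hv₀sq : v₀ ^ 2 = W p := Real.sq_sqrt hWp.le
  set e : EuclideanSpace ℝ (Fin n) :=
    WithLp.toLp 2 (fun i => dd (EuclideanSpace.single i 1, (0:ℝ)) U p / v₀) with he
  have hei : ∀ i, e i = dd (EuclideanSpace.single i 1, (0:ℝ)) U p / v₀ := fun i => rfl
  have hUi' : ∀ i, dd (EuclideanSpace.single i 1, (0:ℝ)) U p = v₀ * e i := by
    intro i; rw [hei]; field_simp
  have hesq : ∑ i, e i ^ 2 = 1 := by
    simp only [hei, div_pow, ← Finset.sum_div]
    rw [hv₀sq]; exact div_self hWp.ne'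
  have hen : ‖e‖ ^ 2 = 1 := by
    rw [EuclideanSpace.norm_sq_eq]; simpa using hesq
  set V := dd (e, (0:ℝ)) U with hV
  have hVs : ContDiffOn ℝ (⊤ : ℕ∞) V O := dd_smooth hO hU _
  have hVp : V p = v₀ := by
    rw [hV, dd_lin2]
    simp only [hUi']
    calc ∑ i, e i * (v₀ * e i) = v₀ * ∑ i, e i ^ 2 := by
          rw [Finset.mul_sum]; exact Finset.sum_congr rfl (fun i _ => by ring)
      _ = v₀ := by rw [hesq, mul_one]
  have hVW : ∀ q, V q ^ 2 ≤ W q := by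
    intro q
    rw [hV, dd_lin2]
    refine (Finset.sum_mul_sq_le_sq_mul_sq _ _ _).trans ?_
    rw [hesq, one_mul]
  have hy2 : ‖y‖ ^ 2 < R ^ 2 := by gcongr
  have hφ0 : 0 < 1 - ‖y‖ ^ 2 / R ^ 2 := by
    rw [sub_pos, div_lt_one (by positivity)]; exact hy2
  -- localized maximum for the function built with `V`
  have hmaxV : ∀ z : EuclideanSpace ℝ (Fin n), ‖z‖ < R → ∀ r : ℝ, t₁ < r → r ≤ t₀ →
      ((r - t₁) / T) * (1 - ‖z‖ ^ 2 / R ^ 2) ^ 2 * V (x₀ + z, r) ^ 2 + A * U (x₀ + z, r) ^ 2 ≤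
      ((t - t₁) / T) * (1 - ‖y‖ ^ 2 / R ^ 2) ^ 2 * V p ^ 2 + A * U p ^ 2 := by
    intro z hz r hr1 hr0
    have h1 := hmax z hz r hr1 hr0
    have h2 : ((r - t₁) / T) * (1 - ‖z‖ ^ 2 / R ^ 2) ^ 2 * V (x₀ + z, r) ^ 2 ≤
        ((r - t₁) / T) * (1 - ‖z‖ ^ 2 / R ^ 2) ^ 2 * W (x₀ + z, r) := by
      have : 0 < r - t₁ := by linarith
      exact mul_le_mul_of_nonneg_left (hVW _) (by positivity)
    rw [hVp, hv₀sq]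
    linarith
  -- smoothness along lines
  have hnear : ∀ w : EuclideanSpace ℝ (Fin n) × ℝ, ∀ᶠ h : ℝ in 𝓝 0, p + h • w ∈ O := by
    intro w
    have hc : Continuous (fun h : ℝ => p + h • w) := by fun_prop
    exact hc.continuousAt.eventually_mem (hO.mem_nhds (by simpa using hp))
  have l1 : ∀ (w : EuclideanSpace ℝ (Fin n) × ℝ) (g : EuclideanSpace ℝ (Fin n) × ℝ → ℝ),
      ContDiffOn ℝ (⊤ : ℕ∞) g O →
      ∀ᶠ h : ℝ in 𝓝 0, HasDerivAt (fun h : ℝ => g (p + h • w)) (dd w g (p + h • w)) h := by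
    intro w g hg
    filter_upwards [hnear w] with h hh
    exact line_deriv hO hg w p hh
  have hnorm : ∀ (i : Fin n) (h : ℝ),
      ‖y + h • EuclideanSpace.single i (1:ℝ)‖ ^ 2 = ‖y‖ ^ 2 + 2 * h * y i + h ^ 2 := by
    intro i h
    rw [norm_add_sq_real, inner_smul_right, norm_smul]
    simp [EuclideanSpace.inner_single_right]
    ring
  have hspace := fun i : Fin n => by
    have hb : HasDerivAt (fun h : ℝ => -(2 * y i + 2 * h) / R ^ 2) (-2 / R ^ 2) 0 := by
      have := ((((hasDerivAt_id (0:ℝ)).const_mul 2).const_add (2 * y i)).neg).div_const (R ^ 2)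
      exact this.congr_deriv (by simp)
    have ha : ∀ᶠ h : ℝ in 𝓝 0, HasDerivAt
        (fun h : ℝ => 1 - (‖y‖ ^ 2 + 2 * h * y i + h ^ 2) / R ^ 2)
        (-(2 * y i + 2 * h) / R ^ 2) h := by
      refine Eventually.of_forall (fun h => ?_)
      have := ((((((hasDerivAt_id h).const_mul 2).mul_const (y i)).const_add (‖y‖ ^ 2)).add
        ((hasDerivAt_id h).pow 2)).div_const (R ^ 2)).const_sub 1
      exact this.congr_deriv (by simp; ring)
    have hm : IsLocalMax (fun h : ℝ => ((t - t₁) / T) *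
        (1 - (‖y‖ ^ 2 + 2 * h * y i + h ^ 2) / R ^ 2) ^ 2 *
        V (p + h • (EuclideanSpace.single i (1:ℝ), (0:ℝ))) ^ 2
        + A * U (p + h • (EuclideanSpace.single i (1:ℝ), (0:ℝ))) ^ 2) 0 := by
      have hc : Continuous (fun h : ℝ => ‖y + h • EuclideanSpace.single i (1:ℝ)‖) := by fun_prop
      have hev : ∀ᶠ h : ℝ in 𝓝 0, ‖y + h • EuclideanSpace.single i (1:ℝ)‖ < R :=
        hc.continuousAt.eventually_lt continuousAt_const (by simpa using hy)
      filter_upwards [hev] with h hh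
      have := hmaxV _ hh t ht1 ht0
      rw [hnorm] at this
      have hpt : p + h • ((EuclideanSpace.single i (1:ℝ) : EuclideanSpace ℝ (Fin n)), (0:ℝ))
          = (x₀ + (y + h • EuclideanSpace.single i (1:ℝ)), t) := by
        simp [hpdef, add_assoc]
      rw [hpt]
      simpa using this
    have key := line_max ha hb (l1 _ V hVs) (l1 _ _ (dd_smooth hO hVs _)).self_of_nhds
      (l1 _ U hU) (l1 _ _ (dd_smooth hO hU _)).self_of_nhds hm
    exact key
  have htime : 0 ≤ (1 - ‖y‖ ^ 2 / R ^ 2) ^ 2 * v₀ ^ 2 / T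
      + 2 * ((t - t₁) / T) * (1 - ‖y‖ ^ 2 / R ^ 2) ^ 2 * v₀ * dd (0, (1:ℝ)) V p
      + 2 * A * U p * dd (0, (1:ℝ)) U p := by
    have a := (l1 (0, (1:ℝ)) V hVs).self_of_nhds
    have b := (l1 (0, (1:ℝ)) U hU).self_of_nhds
    have c : HasDerivAt (fun h : ℝ => (t + h - t₁) / T * (1 - ‖y‖ ^ 2 / R ^ 2) ^ 2)
        (1 / T * (1 - ‖y‖ ^ 2 / R ^ 2) ^ 2) 0 :=
      ((((hasDerivAt_id (0:ℝ)).const_add t).sub_const t₁).div_const T).mul_const _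
    have d := (c.mul (a.pow 2)).add ((b.pow 2).const_mul A)
    have := left_deriv_nonneg d ?_
    · simp only [zero_smul, add_zero, Pi.pow_apply, hVp] at this
      refine this.trans (le_of_eq ?_)
      simp
      ring
    · have h1 : ∀ᶠ h : ℝ in 𝓝[<] 0, t₁ - t < h :=
        mem_nhdsWithin_of_mem_nhds (Ioi_mem_nhds (by linarith))
      filter_upwards [h1, self_mem_nhdsWithin] with h h1 h2
      have h3 : h < 0 := h2
      have := hmaxV y hy (t + h) (by linarith) (by linarith)
      have hpt : p + h • ((0 : EuclideanSpace ℝ (Fin n)), (1:ℝ)) = (x₀ + y, t + h) := by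
        simp [hpdef]
      simp only [Pi.add_apply, Pi.mul_apply, Pi.pow_apply, hpt]
      simpa using this
  simp only [zero_smul, add_zero, mul_zero, zero_mul, ne_eq, OfNat.ofNat_ne_zero,
    not_false_eq_true, zero_pow, hVp] at hspace
  have hs0 : 0 < (t - t₁) / T := div_pos (by linarith) hT
  have hs1 : (t - t₁) / T ≤ 1 := by rw [div_le_one hT]; exact htT
  have hynn : ∑ i, y i ^ 2 = ‖y‖ ^ 2 := by
    rw [EuclideanSpace.norm_sq_eq]; simp
  refine final_alg ((t - t₁) / T) (1 - ‖y‖ ^ 2 / R ^ 2) v₀ (U p) A κ T R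
    (dd (0, (1:ℝ)) V p) (dd (0, (1:ℝ)) U p)
    (fun i => -(2 * y i) / R ^ 2)
    (fun i => dd (EuclideanSpace.single i 1, (0:ℝ)) V p)
    (fun i => dd (EuclideanSpace.single i 1, (0:ℝ)) U p)
    (fun i => dd (EuclideanSpace.single i 1) f p.1)
    (fun i => dd (EuclideanSpace.single i 1, (0:ℝ)) (dd (EuclideanSpace.single i 1, (0:ℝ)) V) p)
    (fun i => dd (EuclideanSpace.single i 1, (0:ℝ)) (dd (EuclideanSpace.single i 1, (0:ℝ)) U) p)
    (-2 / R ^ 2) _ hs0 hs1 hφ0 (by linarith [show 0 ≤ ‖y‖ ^ 2 / R ^ 2 by positivity]) hv₀pos hT hκ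
    (fun i => (hspace i).1) (fun i => (hspace i).2) htime (heq p hp) ?_ hv₀sq.symm ?_ ?_
    (by positivity)
  · rw [hV, V_eq hf hO hU heq e hp]
    have h1 : ∑ i, dd e (dd (EuclideanSpace.single i 1) f) p.1
          * dd (EuclideanSpace.single i 1, (0:ℝ)) U p = v₀ * hessQF f p.1 e := by
      rw [← hess_sum hf, Finset.mul_sum]
      exact Finset.sum_congr rfl (fun i _ => by rw [hUi']; ring)
    rw [h1]
    have h2 := hess p.1 e
    rw [hen] at h2
    nlinarith [mul_le_mul_of_nonneg_left h2 hv₀pos.le]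
  · have : ∑ i, (-(2 * y i) / R ^ 2) ^ 2 = 4 / R ^ 4 * ∑ i, y i ^ 2 := by
      rw [Finset.mul_sum]
      exact Finset.sum_congr rfl (fun i _ => by field_simp; ring)
    rw [this, hynn]
    calc 4 / R ^ 4 * ‖y‖ ^ 2 ≤ 4 / R ^ 4 * R ^ 2 := by gcongr
      _ = 4 / R ^ 2 := by field_simp
  · have h1 : ∑ i : Fin n, (-2 / R ^ 2 - dd (EuclideanSpace.single i 1) f p.1 *
        (-(2 * y i) / R ^ 2)) = (-(2 * n) + 2 * dd y f (x₀ + y)) / R ^ 2 := by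
      rw [dd_lin f y, Finset.sum_sub_distrib, add_div, Finset.mul_sum, Finset.sum_div,
        sub_eq_add_neg, ← Finset.sum_neg_distrib]
      congr 1
      · simp; ring
      · exact Finset.sum_congr rfl (fun i _ => by ring)
    rw [h1, ge_iff_le, ← neg_div]
    have h2 := drift_bound hf hess x₀ y
    have h3 : ‖fderiv ℝ f x₀‖ * ‖y‖ ≤ ‖fderiv ℝ f x₀‖ * R := by gcongr
    have h4 : κ * ‖y‖ ^ 2 ≤ κ * R ^ 2 := by gcongr
    gcongr
    linarith

lemma core_bound {n : ℕ} {f : EuclideanSpace ℝ (Fin n) → ℝ} {κ D ε t₀ : ℝ}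
    {U : EuclideanSpace ℝ (Fin n) × ℝ → ℝ} (x₀ : EuclideanSpace ℝ (Fin n))
    (hf : ContDiff ℝ (⊤ : ℕ∞) f) (hκ : 0 ≤ κ)
    (hess : ∀ x v, hessQF f x v ≥ -κ * ‖v‖ ^ 2)
    (hU : ContDiffOn ℝ (⊤ : ℕ∞) U (univ ×ˢ Iio (0:ℝ)))
    (hD : ∀ p ∈ univ ×ˢ Iio (0:ℝ), 0 < U p ∧ U p ≤ D)
    (heq : ∀ p ∈ univ ×ˢ Iio (0:ℝ), dd (0, (1:ℝ)) U p =
      ∑ i, dd (EuclideanSpace.single i 1, (0:ℝ)) (dd (EuclideanSpace.single i 1, (0:ℝ)) U) p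
      - ∑ i, dd (EuclideanSpace.single i 1) f p.1 * dd (EuclideanSpace.single i 1, (0:ℝ)) U p)
    (ht₀ : t₀ < 0) (hε : 0 < ε) :
    ∑ i, dd (EuclideanSpace.single i 1, (0:ℝ)) U (x₀, t₀) ^ 2 ≤ (3 * κ + ε) * D ^ 2 := by
  have hO : IsOpen ((univ : Set (EuclideanSpace ℝ (Fin n))) ×ˢ Iio (0:ℝ)) :=
    isOpen_univ.prod isOpen_Iio
  set G := ‖fderiv ℝ f x₀‖ with hG
  have hG0 : 0 ≤ G := norm_nonneg _
  set A := 3 * κ + ε with hA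
  have hA0 : 0 < A := by positivity
  set T := 2 / ε with hTd
  have hT : 0 < T := by positivity
  set C : ℝ := 24 + 4 * n + 4 * G with hC
  have hC0 : 0 < C := by positivity
  set R : ℝ := 1 + C / ε with hRd
  have hR1 : 1 ≤ R := by
    have : 0 ≤ C / ε := by positivity
    linarith
  have hR : 0 < R := by linarith
  set W : EuclideanSpace ℝ (Fin n) × ℝ → ℝ :=
    fun p => ∑ i, dd (EuclideanSpace.single i 1, (0:ℝ)) U p ^ 2 with hWdef
  have hW0 : ∀ p, 0 ≤ W p := fun p => Finset.sum_nonneg fun i _ => sq_nonneg _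
  have hWc : ContinuousOn W (univ ×ˢ Iio (0:ℝ)) :=
    continuousOn_finsetSum _ fun i _ => ((dd_smooth hO hU _).continuousOn).pow 2
  set F : EuclideanSpace ℝ (Fin n) × ℝ → ℝ := fun p =>
    ((p.2 - (t₀ - T)) / T) * (1 - ‖p.1 - x₀‖ ^ 2 / R ^ 2) ^ 2 * W p + A * U p ^ 2 with hF
  have hFc : ContinuousOn F (univ ×ˢ Iio (0:ℝ)) := by
    have h1 : Continuous (fun p : EuclideanSpace ℝ (Fin n) × ℝ =>
      ((p.2 - (t₀ - T)) / T) * (1 - ‖p.1 - x₀‖ ^ 2 / R ^ 2) ^ 2) := by fun_prop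
    exact (h1.continuousOn.mul hWc).add (continuousOn_const.mul (hU.continuousOn.pow 2))
  have hS : IsCompact (closedBall x₀ R ×ˢ Icc (t₀ - T) t₀) :=
    (isCompact_closedBall x₀ R).prod isCompact_Icc
  have hsub : closedBall x₀ R ×ˢ Icc (t₀ - T) t₀ ⊆ univ ×ˢ Iio (0:ℝ) := by
    rintro ⟨x, t⟩ ⟨_, h⟩
    exact ⟨mem_univ _, lt_of_le_of_lt h.2 ht₀⟩
  have hmem : (x₀, t₀) ∈ closedBall x₀ R ×ˢ Icc (t₀ - T) t₀ :=
    ⟨mem_closedBall_self hR.le, by constructor <;> linarith⟩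
  obtain ⟨p, hpS, hpmax⟩ := hS.exists_isMaxOn ⟨_, hmem⟩ (hFc.mono hsub)
  have hAU : ∀ q ∈ univ ×ˢ Iio (0:ℝ), A * U q ^ 2 ≤ A * D ^ 2 := by
    intro q hq
    obtain ⟨h1, h2⟩ := hD q hq
    gcongr
  have hcl : W (x₀, t₀) ≤ F p := by
    have h1 : F (x₀, t₀) ≤ F p := hpmax hmem
    have h2 : F (x₀, t₀) = W (x₀, t₀) + A * U (x₀, t₀) ^ 2 := by
      simp [hF, hT.ne']
    have : 0 ≤ A * U (x₀, t₀) ^ 2 := by positivity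
    linarith
  refine hcl.trans ?_
  by_contra! hcon
  have hU' := hAU p (hsub hpS)
  obtain ⟨x, t⟩ := p
  obtain ⟨hx, ht⟩ := hpS
  simp only [mem_closedBall, dist_eq_norm, mem_Icc] at hx ht
  have hprod : 0 < ((t - (t₀ - T)) / T) * (1 - ‖x - x₀‖ ^ 2 / R ^ 2) ^ 2 * W (x, t) := by
    simp only [hF] at hcon
    linarith
  have hWpos : 0 < W (x, t) := by
    rcases (hW0 (x,t)).eq_or_lt with h | h
    · rw [← h, mul_zero] at hprod; exact absurd hprod (lt_irrefl _)
    · exact h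
  have hxR : ‖x - x₀‖ < R := by
    rcases hx.eq_or_lt with h | h
    · rw [h, div_self (by positivity)] at hprod; simp at hprod
    · exact h
  have htt : t₀ - T < t := by
    rcases ht.1.eq_or_lt with h | h
    · rw [← h] at hprod; simp at hprod
    · exact h
  have hxy : x₀ + (x - x₀) = x := by abel
  have key := max_point (A := A) (R := R) (T := T) (t₁ := t₀ - T) (t₀ := t₀) (x₀ := x₀)
    hf hκ hess hO hU heq hR hT (x - x₀) t
    (by rw [hxy]; exact ⟨mem_univ _, lt_of_le_of_lt ht.2 ht₀⟩) hxR htt ht.2 (by linarith [ht.2])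
    (by rw [hxy]; exact hWpos) (by
      intro z hz r hr1 hr0
      rw [hxy]
      have : (x₀ + z, r) ∈ closedBall x₀ R ×ˢ Icc (t₀ - T) t₀ :=
        ⟨by simpa using hz.le, hr1.le, hr0⟩
      have := hpmax this
      simpa [hF] using this)
  have e1 : 1 / T = ε / 2 := by rw [hTd]; field_simp
  have e2 : 2 * ((2 * n + 2 * G * R + 2 * κ * R ^ 2) / R ^ 2)
      = 4 * n / R ^ 2 + 4 * G / R + 4 * κ := by field_simp; ring
  rw [e1, e2] at key
  have e3 : 24 / R ^ 2 ≤ 24 / R := by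
    gcongr
    nlinarith
  have e4 : 4 * (n:ℝ) / R ^ 2 ≤ 4 * n / R := by
    gcongr
    nlinarith
  have e5 : 24 / R + 4 * n / R + 4 * G / R = C / R := by rw [hC]; ring
  have e6 : C / R ≤ ε := by
    rw [div_le_iff₀ hR, hRd]
    have : ε * (1 + C / ε) = ε + C := by field_simp
    linarith
  linarith

lemma norm_gradient_eq {n : ℕ} (g : EuclideanSpace ℝ (Fin n) → ℝ) (x : EuclideanSpace ℝ (Fin n)) :
    ‖gradient g x‖ ^ 2 = ∑ i, dd (EuclideanSpace.single i 1) g x ^ 2 := by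
  rw [EuclideanSpace.norm_sq_eq]
  refine Finset.sum_congr rfl (fun i _ => ?_)
  have h : ⟪gradient g x, EuclideanSpace.single i (1:ℝ)⟫ = dd (EuclideanSpace.single i 1) g x := by
    simp [gradient, dd]
  rw [← h, EuclideanSpace.inner_single_right]
  simp

lemma inner_gradient_eq_s6 {n : ℕ} (f g : EuclideanSpace ℝ (Fin n) → ℝ)
    (x : EuclideanSpace ℝ (Fin n)) :
    ⟪gradient f x, gradient g x⟫ = ∑ i, dd (EuclideanSpace.single i 1) f x
      * dd (EuclideanSpace.single i 1) g x := by
  have h : ∀ (g : EuclideanSpace ℝ (Fin n) → ℝ) (i : Fin n),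
      gradient g x i = dd (EuclideanSpace.single i 1) g x := by
    intro g i
    have h : ⟪gradient g x, EuclideanSpace.single i (1:ℝ)⟫ = dd (EuclideanSpace.single i 1) g x := by
      simp [gradient, dd]
    rw [← h, EuclideanSpace.inner_single_right]
    simp
  rw [PiLp.inner_apply]
  refine Finset.sum_congr rfl (fun i _ => ?_)
  rw [h, h]; simp [mul_comm]

lemma slice_dd {n : ℕ} {U : EuclideanSpace ℝ (Fin n) × ℝ → ℝ} {x : EuclideanSpace ℝ (Fin n)}
    {t : ℝ} (h : DifferentiableAt ℝ U (x, t)) (w : EuclideanSpace ℝ (Fin n)) :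
    dd w (fun y => U (y, t)) x = dd (w, (0:ℝ)) U (x, t) := by
  have h1 : HasFDerivAt (fun y : EuclideanSpace ℝ (Fin n) => (y, t))
      (ContinuousLinearMap.inl ℝ _ ℝ) x := hasFDerivAt_prodMk_left x t
  have := (h.hasFDerivAt.comp x h1).fderiv
  unfold dd
  change fderiv ℝ (U ∘ fun y => (y, t)) x w = _
  rw [this]; simp

lemma slice_within {n : ℕ} {U : EuclideanSpace ℝ (Fin n) × ℝ → ℝ} {x : EuclideanSpace ℝ (Fin n)}
    {t : ℝ} (ht : t ≤ 0) (h : DifferentiableWithinAt ℝ U (univ ×ˢ Iic (0:ℝ)) (x, t))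
    (w : EuclideanSpace ℝ (Fin n)) :
    dd w (fun y => U (y, t)) x = fderivWithin ℝ U (univ ×ˢ Iic (0:ℝ)) (x, t) (w, (0:ℝ)) := by
  have h1 : HasFDerivWithinAt (fun y : EuclideanSpace ℝ (Fin n) => (y, t))
      (ContinuousLinearMap.inl ℝ _ ℝ) univ x := (hasFDerivAt_prodMk_left x t).hasFDerivWithinAt
  have hm : MapsTo (fun y : EuclideanSpace ℝ (Fin n) => (y, t)) univ (univ ×ˢ Iic (0:ℝ)) :=
    fun y _ => ⟨mem_univ _, ht⟩
  have h2 := h.hasFDerivWithinAt.comp x h1 hm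
  have := (hasFDerivWithinAt_univ.1 h2).fderiv
  unfold dd
  change fderiv ℝ (U ∘ fun y => (y, t)) x w = _
  rw [this]; simp

/-- Gradient bound for bounded positive ancient solutions of the `f`-heat equation
(Euclidean case of Corollary 3.1). -/
theorem ancient_fheat_gradient_bound (n : ℕ) (hn : 1 ≤ n) :
    ∃ c : ℝ, 0 < c ∧
      ∀ (f : EuclideanSpace ℝ (Fin n) → ℝ) (K D : ℝ)
        (u : EuclideanSpace ℝ (Fin n) → ℝ → ℝ),
        ContDiff ℝ (⊤ : ℕ∞) f →
        0 ≤ K →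
        (∀ x v : EuclideanSpace ℝ (Fin n),
          hessQF f x v ≥ -((n : ℝ) - 1) * K * ‖v‖ ^ 2) →
        ContDiffOn ℝ (⊤ : ℕ∞) (fun p : EuclideanSpace ℝ (Fin n) × ℝ => u p.1 p.2)
          (univ ×ˢ Iic (0 : ℝ)) →
        (∀ (x : EuclideanSpace ℝ (Fin n)), ∀ t ≤ (0 : ℝ), 0 < u x t ∧ u x t ≤ D) →
        (∀ (x : EuclideanSpace ℝ (Fin n)), ∀ t ≤ (0 : ℝ),
          deriv (fun s => u x s) t = fLap f (fun y => u y t) x) →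
        ∀ (x : EuclideanSpace ℝ (Fin n)), ∀ t ≤ (0 : ℝ),
          ‖gradient (fun y => u y t) x‖ ≤ c * D * Real.sqrt K := by
  refine ⟨Real.sqrt (3 * n), Real.sqrt_pos.2 (by positivity), ?_⟩
  intro f K D u hf hK hess hu hD heq
  set U : EuclideanSpace ℝ (Fin n) × ℝ → ℝ := fun p => u p.1 p.2 with hUdef
  have hn' : (0:ℝ) ≤ (n:ℝ) - 1 := by
    have : (1:ℝ) ≤ n := by exact_mod_cast hn
    linarith
  have hκ : 0 ≤ ((n:ℝ) - 1) * K := mul_nonneg hn' hK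
  have hess' : ∀ x v, hessQF f x v ≥ -(((n:ℝ) - 1) * K) * ‖v‖ ^ 2 := by
    intro x v
    have := hess x v
    linarith
  have hO : IsOpen ((univ : Set (EuclideanSpace ℝ (Fin n))) ×ˢ Iio (0:ℝ)) :=
    isOpen_univ.prod isOpen_Iio
  have hU : ContDiffOn ℝ (⊤ : ℕ∞) U (univ ×ˢ Iio (0:ℝ)) :=
    hu.mono (prod_mono le_rfl Iio_subset_Iic_self)
  have hDU : ∀ p ∈ (univ : Set (EuclideanSpace ℝ (Fin n))) ×ˢ Iio (0:ℝ),
      0 < U p ∧ U p ≤ D := fun p hp => hD p.1 p.2 (le_of_lt hp.2)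
  have hD0 : 0 ≤ D := by
    have := hD 0 0 le_rfl
    linarith
  have hslice : ∀ (g : EuclideanSpace ℝ (Fin n) × ℝ → ℝ),
      ContDiffOn ℝ (⊤ : ℕ∞) g (univ ×ˢ Iio (0:ℝ)) → ∀ x, ∀ t < 0, ∀ w,
      dd w (fun y => g (y, t)) x = dd (w, (0:ℝ)) g (x, t) := by
    intro g hg x t ht w
    exact slice_dd (smooth_diffAt hO hg ⟨mem_univ _, ht⟩) w
  have heqU : ∀ p ∈ (univ : Set (EuclideanSpace ℝ (Fin n))) ×ˢ Iio (0:ℝ),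
      dd (0, (1:ℝ)) U p =
      ∑ i, dd (EuclideanSpace.single i 1, (0:ℝ)) (dd (EuclideanSpace.single i 1, (0:ℝ)) U) p
      - ∑ i, dd (EuclideanSpace.single i 1) f p.1
        * dd (EuclideanSpace.single i 1, (0:ℝ)) U p := by
    rintro ⟨x, t⟩ hp
    have ht : t < 0 := hp.2
    have h1 := heq x t ht.le
    have h2 : deriv (fun s => u x s) t = dd (0, (1:ℝ)) U (x, t) := by
      have hd := (smooth_diffAt hO hU hp).hasFDerivAt
      have hc : HasDerivAt (fun s : ℝ => (x, s)) ((0 : EuclideanSpace ℝ (Fin n)), (1:ℝ)) t :=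
        (hasDerivAt_const t x).prodMk (hasDerivAt_id t)
      exact (hd.comp_hasDerivAt t hc).deriv
    rw [← h2, h1, fLap, inner_gradient_eq_s6]
    congr 1
    · unfold eLap
      refine Finset.sum_congr rfl (fun i _ => ?_)
      have h3 : (fun y => fderiv ℝ (fun y => u y t) y (EuclideanSpace.single i 1))
          = fun y => dd (EuclideanSpace.single i 1, (0:ℝ)) U (y, t) := by
        funext y
        exact hslice U hU y t ht _
      rw [h3]
      exact hslice _ (dd_smooth hO hU _) x t ht _
    · refine Finset.sum_congr rfl (fun i _ => ?_)
      congr 1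
      exact hslice U hU x t ht _
  have hneg : ∀ x, ∀ t < 0, ∑ i, dd (EuclideanSpace.single i 1) (fun y => U (y, t)) x ^ 2
      ≤ 3 * (((n:ℝ) - 1) * K) * D ^ 2 := by
    intro x t ht
    simp only [hslice U hU x t ht]
    have hl : Tendsto (fun ε : ℝ => (3 * (((n:ℝ) - 1) * K) + ε) * D ^ 2) (𝓝[>] 0)
        (𝓝 ((3 * (((n:ℝ) - 1) * K) + 0) * D ^ 2)) := by
      have : Continuous (fun ε : ℝ => (3 * (((n:ℝ) - 1) * K) + ε) * D ^ 2) := by fun_prop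
      exact this.continuousAt.tendsto.mono_left nhdsWithin_le_nhds
    rw [add_zero] at hl
    refine ge_of_tendsto hl ?_
    filter_upwards [self_mem_nhdsWithin] with ε hε
    exact core_bound x hf hκ hess' hU hDU heqU ht hε
  have hall : ∀ x, ∀ t ≤ 0, ∑ i, dd (EuclideanSpace.single i 1) (fun y => U (y, t)) x ^ 2
      ≤ 3 * (((n:ℝ) - 1) * K) * D ^ 2 := by
    intro x t ht
    rcases ht.lt_or_eq with h | rfl
    · exact hneg x t h
    have hud : UniqueDiffOn ℝ ((univ : Set (EuclideanSpace ℝ (Fin n))) ×ˢ Iic (0:ℝ)) :=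
      uniqueDiffOn_univ.prod (uniqueDiffOn_Iic 0)
    have hcd : ContinuousOn (fderivWithin ℝ U (univ ×ˢ Iic (0:ℝ))) (univ ×ˢ Iic (0:ℝ)) :=
      hu.continuousOn_fderivWithin hud (by simp)
    have hdi : DifferentiableOn ℝ U (univ ×ˢ Iic (0:ℝ)) := hu.differentiableOn (by simp)
    have hct : Tendsto (fun s : ℝ => fderivWithin ℝ U (univ ×ˢ Iic (0:ℝ)) (x, s)) (𝓝[<] 0)
        (𝓝 (fderivWithin ℝ U (univ ×ˢ Iic (0:ℝ)) (x, 0))) := by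
      have h1 := hcd (x, 0) ⟨mem_univ _, le_refl (0:ℝ)⟩
      refine Tendsto.comp h1 ?_
      refine tendsto_nhdsWithin_iff.2 ⟨?_, ?_⟩
      · have : Continuous (fun s : ℝ => (x, s)) := by fun_prop
        exact this.continuousAt.tendsto.mono_left nhdsWithin_le_nhds
      · filter_upwards [self_mem_nhdsWithin] with s hs
        have hs' : s < 0 := hs
        exact ⟨mem_univ _, hs'.le⟩
    have hsum : Tendsto (fun s : ℝ => ∑ i : Fin n,
        (fderivWithin ℝ U (univ ×ˢ Iic (0:ℝ)) (x, s) (EuclideanSpace.single i 1, (0:ℝ))) ^ 2)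
        (𝓝[<] 0) (𝓝 (∑ i : Fin n,
        (fderivWithin ℝ U (univ ×ˢ Iic (0:ℝ)) (x, 0) (EuclideanSpace.single i 1, (0:ℝ))) ^ 2)) :=
      tendsto_finsetSum _ fun i _ => (((ContinuousLinearMap.apply ℝ ℝ
        ((EuclideanSpace.single i (1:ℝ) : EuclideanSpace ℝ (Fin n)), (0:ℝ))).continuous.tendsto
          _).comp hct).pow 2
    have h0 : ∀ s ≤ (0:ℝ), ∀ w, dd w (fun y => U (y, s)) x =
        fderivWithin ℝ U (univ ×ˢ Iic (0:ℝ)) (x, s) (w, (0:ℝ)) :=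
      fun s hs w => slice_within hs (hdi (x, s) ⟨mem_univ _, hs⟩) w
    simp only [h0 0 le_rfl]
    refine le_of_tendsto hsum ?_
    filter_upwards [self_mem_nhdsWithin] with s hs
    have := hneg x s hs
    simpa only [h0 s (le_of_lt hs)] using this
  intro x t ht
  have h1 := hall x t ht
  rw [← norm_gradient_eq] at h1
  change ‖gradient (fun y => U (y, t)) x‖ ≤ _
  refine abs_le_of_sq_le_sq' ?_ (by positivity) |>.2
  refine h1.trans ?_
  rw [mul_pow, mul_pow, Real.sq_sqrt (by positivity), Real.sq_sqrt hK]
  nlinarith [mul_nonneg hK (sq_nonneg D)]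
end
end
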